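/- Let A be a σ-unital C*-algebra. Assume that for every sequence (a_i) of pairwise orthogonal positive elements of A there exist m, n ∈ ℕ such that m·[a_i] is weakly (2m,n)-divisible in Cu(A) for every i. Then the multiplier algebra M(A) is nowhere scattered. -/

import Mathlib

/-!
Common definitions: abstract Cuntz semigroups, divisibility, and C*-algebra notions
(nowhere scatteredness, σ-unitality, etc.) used to formalize the statements.
-/

open scoped MultiplierAlgebra ENNReal
open Filter Topology

noncomputable section

universe uu vv

/-- The (sequential) way-below relation `x ≪ y` (compact containment) in a partially
ordered set: whenever an increasing sequence has a supremum lying above `y`, some term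
of the sequence already lies above `x`. -/
def WayBelow {S : Type*} [PartialOrder S] (x y : S) : Prop :=
  ∀ f : ℕ → S, Monotone f → ∀ s : S, IsLUB (Set.range f) s → y ≤ s → ∃ n, x ≤ f n

/-- An abstract Cuntz semigroup (`Cu`-semigroup): a positively ordered abelian monoid in
which every increasing sequence has a supremum, every element is the supremum of a
`≪`-increasing sequence, addition preserves `≪`, and which satisfies the standard
axioms (O5) (almost algebraic order) and (O6) (almost Riesz decomposition), as well as
the existence of infima with idempotents `∞y = sup_n n•y` (all of these hold in the
Cuntz semigroup of any C*-algebra). -/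
class CuSemigroup (S : Type*) extends AddCommMonoid S, PartialOrder S where
  add_le_add' : ∀ a b : S, a ≤ b → ∀ c : S, c + a ≤ c + b
  zero_le' : ∀ x : S, 0 ≤ x
  exists_isLUB : ∀ f : ℕ → S, Monotone f → ∃ s : S, IsLUB (Set.range f) s
  exists_waybelow_seq : ∀ x : S, ∃ f : ℕ → S, Monotone f ∧
    (∀ n, WayBelow (f n) (f (n + 1))) ∧ IsLUB (Set.range f) x
  waybelow_add : ∀ {x y z w : S}, WayBelow x y → WayBelow z w → WayBelow (x + z) (y + w)
  /-- axiom (O5) -/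
  almost_algebraic : ∀ x' x y' y z : S, WayBelow x' x → WayBelow y' y → x + y ≤ z →
    ∃ c : S, y' ≤ c ∧ x' + c ≤ z ∧ z ≤ x + c
  /-- axiom (O6) -/
  almost_riesz : ∀ x' x y z : S, WayBelow x' x → x ≤ y + z →
    ∃ v w : S, v ≤ x ∧ v ≤ y ∧ w ≤ x ∧ w ≤ z ∧ x' ≤ v + w
  /-- `infty y = ∞·y = sup_n n•y` -/
  infty : S → S
  isLUB_infty : ∀ y : S, IsLUB (Set.range fun n : ℕ => n • y) (infty y)
  /-- the infimum `x ⊓ ∞y`, which exists in the Cuntz semigroup of any C*-algebra -/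
  meetInfty : S → S → S
  isGLB_meetInfty : ∀ x y : S, IsGLB {x, infty y} (meetInfty x y)

namespace CuDiv

variable {S : Type*} [CuSemigroup S]

/-- `x` is weakly `(m, n)`-divisible. -/
def IsWeaklyDivisible (m n : ℕ) (x : S) : Prop :=
  ∀ x' : S, WayBelow x' x → ∃ y : Fin n → S, x' ≤ ∑ j, y j ∧ ∀ j, m • y j ≤ x

/-- `x` is `(m, n)`-divisible. -/
def IsDivisible (m n : ℕ) (x : S) : Prop :=
  ∀ x' : S, WayBelow x' x → ∃ y : S, x' ≤ n • y ∧ m • y ≤ x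

/-- `x` is weakly `(m, ω)`-divisible. -/
def IsWeaklyOmegaDivisible (m : ℕ) (x : S) : Prop :=
  ∀ x' : S, WayBelow x' x → ∃ (n : ℕ) (y : Fin n → S), x' ≤ ∑ j, y j ∧ ∀ j, m • y j ≤ x

/-- `x` is `(m, ω)`-divisible. -/
def IsOmegaDivisible (m : ℕ) (x : S) : Prop :=
  ∀ x' : S, WayBelow x' x → ∃ (y : S) (n : ℕ), x' ≤ n • y ∧ m • y ≤ x

/-- `wdiv m x` is the least positive integer `n` such that `x` is weakly
`(m,n)`-divisible, and `∞` if there is no such `n`. -/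
def wdiv (m : ℕ) (x : S) : ℕ∞ :=
  sInf {N : ℕ∞ | ∃ n : ℕ, 1 ≤ n ∧ N = n ∧ IsWeaklyDivisible m n x}

/-- `Div m x` is the least positive integer `n` such that `x` is `(m,n)`-divisible,
and `∞` if there is no such `n`. -/
def Div (m : ℕ) (x : S) : ℕ∞ :=
  sInf {N : ℕ∞ | ∃ n : ℕ, 1 ≤ n ∧ N = n ∧ IsDivisible m n x}

/-- An element `x` is strongly soft if for every `x' ≪ x` there is `t` with
`x' + t ≤ x ≤ ∞t`. -/
def StronglySoft (x : S) : Prop :=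
  ∀ x' : S, WayBelow x' x → ∃ t : S, x' + t ≤ x ∧ x ≤ CuSemigroup.infty t

/-- The Cuntz semigroup characterization of the Global Glimm Property: every element is
`(m, ω)`-divisible for every `m`. -/
def GlobalGlimm (S : Type*) [CuSemigroup S] : Prop :=
  ∀ (m : ℕ) (x : S), IsOmegaDivisible m x

/-- `Cu(A)` is left-soft separative. -/
def LeftSoftSeparative (S : Type*) [CuSemigroup S] : Prop :=
  ∀ x y t : S, StronglySoft x → WayBelow (x + t) (y + t) →
    WayBelow t (CuSemigroup.infty y) → WayBelow t (CuSemigroup.infty x) → WayBelow x y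

/-- `Cu(A)` is weakly cancellative. -/
def WeaklyCancellative (S : Type*) [CuSemigroup S] : Prop :=
  ∀ x y z : S, WayBelow (x + z) (y + z) → WayBelow x y

/-- `Cu(A)` has covering dimension zero. -/
def CoveringDimZero (S : Type*) [CuSemigroup S] : Prop :=
  ∀ x' x y₁ y₂ : S, WayBelow x' x → WayBelow x (y₁ + y₂) →
    ∃ z₁ z₂ : S, z₁ ≤ y₁ ∧ z₂ ≤ y₂ ∧ x' ≤ z₁ + z₂ ∧ z₁ + z₂ ≤ x

end CuDiv

/-- A functional on a Cuntz semigroup: an additive, order preserving map to `ℝ≥0∞`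
preserving suprema of increasing sequences.  (By Elliott–Robert–Santiago, the
functionals on `Cu(A)` are exactly those induced by the lower semicontinuous
2-quasitraces on `A ⊗ K`.) -/
structure CuFunctional (S : Type*) [CuSemigroup S] where
  toFun : S → ℝ≥0∞
  map_zero' : toFun 0 = 0
  map_add' : ∀ x y : S, toFun (x + y) = toFun x + toFun y
  mono' : ∀ x y : S, x ≤ y → toFun x ≤ toFun y
  sup' : ∀ f : ℕ → S, Monotone f → ∀ s : S, IsLUB (Set.range f) s →
    toFun s = ⨆ n, toFun (f n)

instance {S : Type*} [CuSemigroup S] : CoeFun (CuFunctional S) fun _ => S → ℝ≥0∞ :=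
  ⟨CuFunctional.toFun⟩

namespace CuDiv

variable {S : Type*} [CuSemigroup S]

/-- `x <ₛ y` : there is `γ < 1` with `λ(x) ≤ γ·λ(y)` for every functional `λ`. -/
def FunctionalLT (x y : S) : Prop :=
  ∃ γ : ℝ≥0∞, γ < 1 ∧ ∀ lam : CuFunctional S, lam x ≤ γ * lam y

/-- `A` has `k`-comparison (stated on `Cu(A)`). -/
def KComparison (S : Type*) [CuSemigroup S] (k : ℕ) : Prop :=
  ∀ (x : S) (b : Fin (k + 1) → S), (∀ i, FunctionalLT x (b i)) → x ≤ ∑ i, b i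

/-- `A` has strict comparison (stated on `Cu(A)`, via functionals, which correspond to
the lower semicontinuous 2-quasitraces). -/
def StrictComparison (S : Type*) [CuSemigroup S] : Prop :=
  ∀ x y : S, FunctionalLT x y → x ≤ y

/-- The natural topology on the cone `F(Cu(A))` of functionals. -/
def functionalTopology (S : Type*) [CuSemigroup S] : TopologicalSpace (CuFunctional S) :=
  TopologicalSpace.generateFrom
    ({U | ∃ (x : S) (r : ℝ≥0∞), U = {lam : CuFunctional S | r < lam x}} ∪
      {U | ∃ (x' x : S) (r : ℝ≥0∞), WayBelow x' x ∧ U = {lam : CuFunctional S | lam x' < r}})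

/-- A lower semicontinuous affine function on the cone of functionals of `Cu(A)`,
i.e. an element of `L(F(Cu(A)))`. -/
def IsLscAffine (F : CuFunctional S → ℝ≥0∞) : Prop :=
  (letI := functionalTopology S; LowerSemicontinuous F) ∧
    (∀ lam mu nu : CuFunctional S, (∀ x, nu x = lam x + mu x) → F nu = F lam + F mu) ∧
    (∀ (r : ℝ≥0∞) (lam nu : CuFunctional S), (∀ x, nu x = r * lam x) → F nu = r * F lam)

/-- The rank map of `Cu(A)` is surjective: every lower semicontinuous affine function on
the cone of functionals is realized as the rank function `λ ↦ λ(x)` of an element. -/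
def SurjectiveRankMap (S : Type*) [CuSemigroup S] : Prop :=
  ∀ F : CuFunctional S → ℝ≥0∞, IsLscAffine F → ∃ y : S, ∀ lam : CuFunctional S, lam y = F lam

end CuDiv

/-! ### C*-algebra notions -/

section CStar

variable {B : Type*} [NonUnitalCStarAlgebra B]

/-- Positivity in a C*-algebra: `a` is positive iff it is of the form `star b * b`. -/
def CStarNonneg (a : B) : Prop := ∃ b : B, a = star b * b

/-- Cuntz subequivalence `a ≼ b` : `a = lim_n rₙ b rₙ*`. -/
def CuntzBelow (a b : B) : Prop :=
  ∃ r : ℕ → B, Tendsto (fun n => r n * b * star (r n)) atTop (𝓝 a)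

/-- Cuntz equivalence. -/
def CuntzEquiv (a b : B) : Prop := CuntzBelow a b ∧ CuntzBelow b a

/-- `A` is σ-unital: it has a countable (norm-bounded, positive) approximate unit. -/
def SigmaUnital (A : Type*) [NonUnitalCStarAlgebra A] : Prop :=
  ∃ e : ℕ → A, (∀ n, CStarNonneg (e n) ∧ ‖e n‖ ≤ 1) ∧
    ∀ a : A, Tendsto (fun n => e n * a) atTop (𝓝 a) ∧ Tendsto (fun n => a * e n) atTop (𝓝 a)

end CStar

/-- A closed two-sided (automatically star-closed) ideal of a C*-algebra. -/
structure ClosedTwoSidedIdealC (A : Type*) [NonUnitalCStarAlgebra A] where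
  carrier : NonUnitalStarSubalgebra ℂ A
  isClosed : IsClosed (carrier : Set A)
  mul_mem_left : ∀ a : A, ∀ x ∈ carrier, a * x ∈ carrier
  mul_mem_right : ∀ a : A, ∀ x ∈ carrier, x * a ∈ carrier

section Reps

variable {A : Type*} [NonUnitalCStarAlgebra A]
variable {H : Type*} [NormedAddCommGroup H] [InnerProductSpace ℂ H] [CompleteSpace H]

/-- A (topologically) irreducible representation of `A` on a Hilbert space `H`. -/
def IsIrreducibleRep (π : A →⋆ₙₐ[ℂ] (H →L[ℂ] H)) : Prop :=
  (∃ a : A, π a ≠ 0) ∧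
    ∀ K : Submodule ℂ H, IsClosed (K : Set H) → (∀ a : A, ∀ v ∈ K, π a v ∈ K) →
      K = ⊥ ∨ K = ⊤

end Reps

/-- `A` has a nonzero elementary ideal-quotient `J/I`, expressed via a surjection of a
closed two-sided ideal `J` of `A` onto the algebra of compact operators on a Hilbert
space (the kernel `I` of such a `*`-homomorphism is automatically a closed two-sided
ideal of `A`, and conversely any nonzero elementary ideal-quotient arises this way). -/
def HasNonzeroElementaryIdealQuotient (A : Type*) [NonUnitalCStarAlgebra A] : Prop :=
  ∃ (J : ClosedTwoSidedIdealC A) (H : Type) (_ : NormedAddCommGroup H)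
    (_ : InnerProductSpace ℂ H) (_ : CompleteSpace H)
    (ψ : J.carrier →⋆ₙₐ[ℂ] (H →L[ℂ] H)),
      Set.range ψ = {T : H →L[ℂ] H | IsCompactOperator ⇑T} ∧ ∃ x, ψ x ≠ 0

/-- A C*-algebra is nowhere scattered if no ideal-quotient of it is nonzero and
elementary. -/
def NowhereScattered (A : Type*) [NonUnitalCStarAlgebra A] : Prop :=
  ¬ HasNonzeroElementaryIdealQuotient A

/-- A C*-algebra is elementary if it is isomorphic to the algebra of compact operators
on some Hilbert space. -/
def IsElementaryCStar (A : Type*) [NonUnitalCStarAlgebra A] : Prop :=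
  ∃ (H : Type) (_ : NormedAddCommGroup H) (_ : InnerProductSpace ℂ H) (_ : CompleteSpace H)
    (ψ : A →⋆ₙₐ[ℂ] (H →L[ℂ] H)),
      Function.Injective ψ ∧ Set.range ψ = {T : H →L[ℂ] H | IsCompactOperator ⇑T}

/-- A C*-algebra is simple if it is nonzero and has no nontrivial closed two-sided
ideals. -/
def IsSimpleCStar (A : Type*) [NonUnitalCStarAlgebra A] : Prop :=
  (∃ a : A, a ≠ 0) ∧
    ∀ J : ClosedTwoSidedIdealC A, (J.carrier : Set A) = {0} ∨ (J.carrier : Set A) = Set.univ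

/-- Real rank zero: the invertible self-adjoint elements are dense in the self-adjoint
part of the minimal unitization. -/
def RealRankZero (A : Type*) [NonUnitalCStarAlgebra A] : Prop :=
  ∀ x : Unitization ℂ A, IsSelfAdjoint x →
    x ∈ closure {y : Unitization ℂ A | IsSelfAdjoint y ∧ IsUnit y}

/-- Stable rank one: the invertible elements are dense in the minimal unitization. -/
def StableRankOne (A : Type*) [NonUnitalCStarAlgebra A] : Prop :=
  ∀ x : Unitization ℂ A, x ∈ closure {y : Unitization ℂ A | IsUnit y}

section CP

variable {A B : Type*} [NonUnitalCStarAlgebra A] [NonUnitalCStarAlgebra B]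

/-- A linear map between C*-algebras is completely positive if all of its matrix
amplifications preserve positivity. -/
def IsCompletelyPositive (φ : A →ₗ[ℂ] B) : Prop :=
  ∀ (n : ℕ) (a : Matrix (Fin n) (Fin n) A), (∃ b : Matrix (Fin n) (Fin n) A, a = star b * b) →
    ∃ c : Matrix (Fin n) (Fin n) B, a.map ⇑φ = star c * c

/-- A completely positive contractive (c.p.c.) map. -/
def IsCPC (φ : A →ₗ[ℂ] B) : Prop :=
  IsCompletelyPositive φ ∧ ∀ a : A, ‖φ a‖ ≤ ‖a‖

/-- A map between C*-algebras has order zero if it preserves orthogonality of positive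
elements. -/
def IsOrderZero (φ : A →ₗ[ℂ] B) : Prop :=
  ∀ a b : A, CStarNonneg a → CStarNonneg b → a * b = 0 → φ a * φ b = 0

end CP

/-- `A` has nuclear dimension at most `k`: there are c.p.c. approximations of the
identity through finite dimensional C*-algebras in which the downwards maps are sums of
`k+1` c.p.c. order zero maps. -/
def NuclearDimLE (A : Type*) [NonUnitalCStarAlgebra A] (k : ℕ) : Prop :=
  ∀ (F : Finset A) (ε : ℝ), 0 < ε →
    ∃ (Fd : Type) (_ : NonUnitalCStarAlgebra Fd) (_ : FiniteDimensional ℂ Fd)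
      (ψ : A →ₗ[ℂ] Fd) (φ : Fin (k + 1) → (Fd →ₗ[ℂ] A)),
        IsCPC ψ ∧ (∀ i, IsCPC (φ i) ∧ IsOrderZero (φ i)) ∧
        ∀ a ∈ F, ‖(∑ i, φ i (ψ a)) - a‖ ≤ ε

section Prim

variable (A : Type*) [NonUnitalCStarAlgebra A]

/-- A primitive ideal: the kernel of an irreducible representation. -/
def IsPrimitiveIdeal {A : Type*} [NonUnitalCStarAlgebra A] (J : ClosedTwoSidedIdealC A) : Prop :=
  ∃ (H : Type) (_ : NormedAddCommGroup H) (_ : InnerProductSpace ℂ H) (_ : CompleteSpace H)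
    (π : A →⋆ₙₐ[ℂ] (H →L[ℂ] H)),
      IsIrreducibleRep π ∧ ∀ a : A, a ∈ J.carrier ↔ π a = 0

/-- The primitive ideal space of `A`. -/
def PrimIdealSpace := {J : ClosedTwoSidedIdealC A // IsPrimitiveIdeal J}

/-- The hull-kernel (Jacobson) topology on the primitive ideal space. -/
instance : TopologicalSpace (PrimIdealSpace A) :=
  TopologicalSpace.generateFrom {U | ∃ a : A, U = {P : PrimIdealSpace A | a ∉ P.1.carrier}}

/-- `A` has topological dimension zero: the primitive ideal space has a basis of
compact open sets. -/
def TopDimZero : Prop :=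
  ∃ 𝒷 : Set (Set (PrimIdealSpace A)), TopologicalSpace.IsTopologicalBasis 𝒷 ∧
    ∀ U ∈ 𝒷, IsCompact U ∧ IsOpen U

end Prim

section Proj

variable {B : Type*} [NonUnitalCStarAlgebra B]

/-- A projection in a C*-algebra. -/
def IsProjectionElem (p : B) : Prop := IsSelfAdjoint p ∧ p * p = p

/-- `B` contains an infinite projection: a projection which is Murray-von Neumann
equivalent to a proper subprojection of itself. -/
def HasInfiniteProjection (B : Type*) [NonUnitalCStarAlgebra B] : Prop :=
  ∃ p v : B, IsProjectionElem p ∧ star v * v = p ∧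
    p * (v * star v) = v * star v ∧ v * star v ≠ p

end Proj

/-! ### The Cuntz semigroup of a C*-algebra -/

/-- Padding a matrix by one extra row and column of zeros. -/
def matPad {A : Type*} [Zero A] {n : ℕ} (a : Matrix (Fin n) (Fin n) A) :
    Matrix (Fin (n + 1)) (Fin (n + 1)) A :=
  Matrix.of fun i j =>
    if h : (i : ℕ) < n ∧ (j : ℕ) < n then a ⟨i, h.1⟩ ⟨j, h.2⟩ else 0

/-- A witness that `S` is the Cuntz semigroup of the C*-algebra `A`: it provides a
stabilization `stab` of `A` (a model of `A ⊗ K`, described as the C*-completion of the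
union of the matrix algebras `Mₙ(A)`), together with the class map
`cls : (stab)₊ → S = Cu(A)` identifying `S` with the set of Cuntz equivalence classes of
positive elements of `A ⊗ K`, with order induced by Cuntz subequivalence, addition
induced by orthogonal (diagonal) addition, and with the compact containment relation
`≪` given by `x ≪ [a]` iff `x ≤ [(a - ε)₊]` for some `ε > 0`. -/
structure IsCuntzSemigroupOf (A : Type uu) [NonUnitalCStarAlgebra A]
    (S : Type vv) [CuSemigroup S] where
  stab : Type (max uu vv)
  [stabCStar : NonUnitalCStarAlgebra stab]
  matEmb : (n : ℕ) → (Matrix (Fin n) (Fin n) A →⋆ₙₐ[ℂ] stab)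
  matEmb_injective : ∀ n, Function.Injective (matEmb n)
  matEmb_compat : ∀ (n : ℕ) (a : Matrix (Fin n) (Fin n) A), matEmb (n + 1) (matPad a) = matEmb n a
  matEmb_dense : Dense (⋃ n, Set.range (matEmb n))
  cls : stab → S
  cls_zero : cls 0 = 0
  cls_surj : ∀ s : S, ∃ b : stab, CStarNonneg b ∧ cls b = s
  cls_le_iff : ∀ a b : stab, CStarNonneg a → CStarNonneg b → (cls a ≤ cls b ↔ CuntzBelow a b)
  cls_add_orth : ∀ a b : stab, CStarNonneg a → CStarNonneg b → a * b = 0 →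
    cls (a + b) = cls a + cls b
  exists_orth : ∀ a b : stab, CStarNonneg a → CStarNonneg b →
    ∃ a' b' : stab, CStarNonneg a' ∧ CStarNonneg b' ∧ a' * b' = 0 ∧
      cls a' = cls a ∧ cls b' = cls b
  waybelow_iff : ∀ (x : S) (a : stab), CStarNonneg a →
    (WayBelow x (cls a) ↔ ∃ ε : ℝ, 0 < ε ∧ x ≤ cls (cfcₙ (fun t : ℝ => max (t - ε) 0) a))

attribute [instance] IsCuntzSemigroupOf.stabCStar

/-- The Cuntz class `[a] ∈ Cu(A)` of an element `a` of `A` itself (via the canonical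
embedding `A ≅ M₁(A) ⊆ A ⊗ K`). -/
def IsCuntzSemigroupOf.clsA {A : Type*} [NonUnitalCStarAlgebra A] {S : Type*} [CuSemigroup S]
    (h : IsCuntzSemigroupOf A S) (a : A) : S :=
  h.cls (h.matEmb 1 (Matrix.of fun _ _ => a))

/-- `B` has a surjective rank map (every lower semicontinuous affine function on the
cone of functionals on `Cu(B)` is realized as a rank function). -/
def HasSurjectiveRankMap (B : Type*) [NonUnitalCStarAlgebra B] : Prop :=
  ∀ (S : Type) (inst : CuSemigroup S), IsCuntzSemigroupOf B S → CuDiv.SurjectiveRankMap S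

/-- The family of separable sub-C*-algebras of `A` having a surjective rank map. -/
def sepSurjRankFamily (A : Type*) [NonUnitalCStarAlgebra A] :
    Set (NonUnitalStarSubalgebra ℂ A) :=
  {B | ∃ _h : IsClosed (B : Set A),
    TopologicalSpace.SeparableSpace B ∧ HasSurjectiveRankMap B}

/-- The family of separable sub-C*-algebras of `A` with a surjective rank map is
σ-complete (closed under countable increasing unions) and cofinal (every separable
sub-C*-algebra is contained in a member). -/
def SepSurjRankFamilySigmaCompleteCofinal (A : Type*) [NonUnitalCStarAlgebra A] : Prop :=
  (∀ Bseq : ℕ → NonUnitalStarSubalgebra ℂ A, Monotone Bseq →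
    (∀ n, Bseq n ∈ sepSurjRankFamily A) →
      (⨆ n, Bseq n).topologicalClosure ∈ sepSurjRankFamily A) ∧
  (∀ C : NonUnitalStarSubalgebra ℂ A, IsClosed (C : Set A) →
    TopologicalSpace.SeparableSpace C → ∃ B ∈ sepSurjRankFamily A, C ≤ B)

end

section StrictSums

variable {A : Type*} [NonUnitalCStarAlgebra A]

/-- `T` is the sum of the series `∑ i, t i` in the strict topology of the multiplier algebra. -/
structure IsStrictSum (t : ℕ → A) (T : 𝓜(ℂ, A)) : Prop where
  left : ∀ x, Tendsto (fun N => ∑ i ∈ Finset.range N, t i * x) atTop (𝓝 (T.fst x))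
  right : ∀ x, Tendsto (fun N => ∑ i ∈ Finset.range N, x * t i) atTop (𝓝 (T.snd x))

/-- Every two-sided annihilation relation satisfied by `a` is satisfied by `t`. -/
def SupportedBy (a t : A) : Prop :=
  (∀ x, a * x = 0 → t * x = 0) ∧ ∀ x, x * a = 0 → x * t = 0

/-- Pairwise orthogonal self-adjoint elements whose bounded multiples can be strictly summed. -/
structure StrictlyOrthogonal (a : ℕ → A) : Prop where
  selfAdjoint : ∀ i, IsSelfAdjoint (a i)
  orth : ∀ i j, i ≠ j → a i * a j = 0
  tail : ∀ x : A, ∀ ε > 0, ∃ y, ‖x - y‖ < ε ∧ ∃ N, ∀ i ≥ N, a i * y = 0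

theorem norm_sum_le_of_orthogonal {t : ℕ → A} {C : ℝ} (hC : 0 ≤ C) (hb : ∀ i, ‖t i‖ ≤ C)
    (h₁ : ∀ i j, i ≠ j → star (t i) * t j = 0) (h₂ : ∀ i j, i ≠ j → t i * star (t j) = 0)
    (s : Finset ℕ) : ‖∑ i ∈ s, t i‖ ≤ C := by
  have key : star (∑ i ∈ s, t i) * ∑ i ∈ s, t i = ∑ i ∈ s, star (t i) * t i := by
    rw [star_sum, Finset.sum_mul]
    refine Finset.sum_congr rfl fun i hi => ?_
    rw [Finset.mul_sum]
    exact Finset.sum_eq_single_of_mem i hi fun j _ hj => h₁ i j hj.symm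
  have hn : ‖∑ i ∈ s, star (t i) * t i‖₊ ≤ (⟨C, hC⟩ : NNReal) ^ 2 := by
    rw [IsSelfAdjoint.nnnorm_sum_eq_sup s (fun i _ => IsSelfAdjoint.star_mul_self (t i))]
    · refine Finset.sup_le fun i _ => ?_
      rw [CStarRing.nnnorm_star_mul_self, ← sq]
      exact pow_le_pow_left₀ (norm_nonneg _) (hb i) 2
    · intro i j hij
      change star (t i) * t i * (star (t j) * t j) = 0
      rw [mul_assoc, ← mul_assoc (t i), h₂ i j hij, zero_mul, mul_zero]
  have hn' : ‖∑ i ∈ s, t i‖ * ‖∑ i ∈ s, t i‖ ≤ C ^ 2 := by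
    rw [← CStarRing.norm_star_mul_self, key]
    exact_mod_cast hn
  nlinarith [norm_nonneg (∑ i ∈ s, t i)]

namespace SupportedBy

theorem refl (a : A) : SupportedBy a a := ⟨fun _ h => h, fun _ h => h⟩

theorem add {a s t : A} (hs : SupportedBy a s) (ht : SupportedBy a t) : SupportedBy a (s + t) :=
  ⟨fun x hx => by rw [add_mul, hs.1 x hx, ht.1 x hx, add_zero],
    fun x hx => by rw [mul_add, hs.2 x hx, ht.2 x hx, add_zero]⟩

theorem sub {a s t : A} (hs : SupportedBy a s) (ht : SupportedBy a t) : SupportedBy a (s - t) :=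
  ⟨fun x hx => by rw [sub_mul, hs.1 x hx, ht.1 x hx, sub_zero],
    fun x hx => by rw [mul_sub, hs.2 x hx, ht.2 x hx, sub_zero]⟩

theorem mul {a s t : A} (hs : SupportedBy a s) (ht : SupportedBy a t) : SupportedBy a (s * t) :=
  ⟨fun x hx => by rw [mul_assoc, ht.1 x hx, mul_zero],
    fun x hx => by rw [← mul_assoc, hs.2 x hx, zero_mul]⟩

theorem zero (a : A) : SupportedBy a 0 := ⟨fun x _ => zero_mul x, fun x _ => mul_zero x⟩

theorem sum {a : A} {ι : Type*} (s : Finset ι) {t : ι → A} (h : ∀ i ∈ s, SupportedBy a (t i)) :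
    SupportedBy a (∑ i ∈ s, t i) :=
  Finset.sum_induction t (SupportedBy a) (fun _ _ => add) (zero a) h

theorem star {a t : A} (ha : IsSelfAdjoint a) (ht : SupportedBy a t) :
    SupportedBy a (star t) := by
  constructor
  · intro x hx
    have : Star.star x * a = 0 := by
      have := congrArg Star.star hx
      rwa [star_mul, ha.star_eq, star_zero] at this
    simpa using congrArg Star.star (ht.2 _ this)
  · intro x hx
    have : a * Star.star x = 0 := by
      have := congrArg Star.star hx
      rwa [star_mul, ha.star_eq, star_zero] at this
    simpa using congrArg Star.star (ht.1 _ this)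

theorem trans {a b c : A} (hb : SupportedBy a b) (hc : SupportedBy b c) : SupportedBy a c :=
  ⟨fun x hx => hc.1 x (hb.1 x hx), fun x hx => hc.2 x (hb.2 x hx)⟩

theorem of_unit {p t : A} (h₁ : p * t = t) (h₂ : t * p = t) : SupportedBy p t :=
  ⟨fun x hx => by rw [← h₂, mul_assoc, hx, mul_zero],
    fun x hx => by rw [← h₁, ← mul_assoc, hx, zero_mul]⟩

theorem mul_eq_zero {a b s t : A} (hs : SupportedBy a s) (ht : SupportedBy b t)
    (h : a * b = 0) : s * t = 0 :=
  hs.1 _ (ht.2 _ h)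

end SupportedBy

namespace StrictlyOrthogonal

variable {a : ℕ → A}

theorem norm_sum_le (ha : StrictlyOrthogonal a) {t : ℕ → A} {C : ℝ} (hC : 0 ≤ C)
    (hb : ∀ i, ‖t i‖ ≤ C) (ht : ∀ i, SupportedBy (a i) (t i)) (s : Finset ℕ) :
    ‖∑ i ∈ s, t i‖ ≤ C :=
  norm_sum_le_of_orthogonal hC hb
    (fun i j hij => ((ht i).star (ha.selfAdjoint i)).mul_eq_zero (ht j) (ha.orth i j hij))
    (fun i j hij => (ht i).mul_eq_zero ((ht j).star (ha.selfAdjoint j)) (ha.orth i j hij)) s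

theorem exists_tendsto (ha : StrictlyOrthogonal a) {t : ℕ → A} {C : ℝ} (hC : 0 ≤ C)
    (hb : ∀ i, ‖t i‖ ≤ C) (ht : ∀ i, SupportedBy (a i) (t i)) (x : A) :
    ∃ z, Tendsto (fun N => ∑ i ∈ Finset.range N, t i * x) atTop (𝓝 z) := by
  refine cauchySeq_tendsto_of_complete (Metric.cauchySeq_iff'.2 fun ε hε => ?_)
  obtain ⟨y, hy, N, hN⟩ := ha.tail x (ε / (C + 1)) (by positivity)
  refine ⟨N, fun n hn => ?_⟩
  rw [dist_eq_norm, ← Finset.sum_Ico_eq_sub _ hn]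
  have : ∑ i ∈ Finset.Ico N n, t i * x = (∑ i ∈ Finset.Ico N n, t i) * (x - y) := by
    rw [Finset.sum_mul]
    refine Finset.sum_congr rfl fun i hi => ?_
    rw [mul_sub, (ht i).1 y (hN i (Finset.mem_Ico.1 hi).1), sub_zero]
  rw [this]
  calc _ ≤ C * ‖x - y‖ := (norm_mul_le _ _).trans
        (mul_le_mul_of_nonneg_right (ha.norm_sum_le hC hb ht _) (norm_nonneg _))
    _ ≤ C * (ε / (C + 1)) := mul_le_mul_of_nonneg_left hy.le hC
    _ < ε := by
        rw [mul_div_assoc', div_lt_iff₀ (by positivity)]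
        nlinarith

theorem exists_isStrictSum (ha : StrictlyOrthogonal a) {t : ℕ → A} {C : ℝ} (hC : 0 ≤ C)
    (hb : ∀ i, ‖t i‖ ≤ C) (ht : ∀ i, SupportedBy (a i) (t i)) :
    ∃ T, IsStrictSum t T := by
  choose L hL using ha.exists_tendsto hC hb ht
  choose R' hR' using ha.exists_tendsto (t := fun i => star (t i)) hC
    (fun i => by rw [norm_star]; exact hb i) (fun i => (ht i).star (ha.selfAdjoint i))
  have hR : ∀ x, Tendsto (fun N => ∑ i ∈ Finset.range N, x * t i) atTop
      (𝓝 (star (R' (star x)))) := fun x => by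
    simpa [star_sum] using (hR' (star x)).star
  let gL : ℕ → A →L[ℂ] A := fun N => ContinuousLinearMap.mul ℂ A (∑ i ∈ Finset.range N, t i)
  let gR : ℕ → A →L[ℂ] A := fun N =>
    (ContinuousLinearMap.mul ℂ A).flip (∑ i ∈ Finset.range N, t i)
  have hgL : Tendsto (fun n x => gL n x) atTop (𝓝 L) := by
    rw [tendsto_pi_nhds]
    intro x
    simpa [gL, Finset.sum_mul] using hL x
  have hgR : Tendsto (fun n x => gR n x) atTop (𝓝 fun x => star (R' (star x))) := by
    rw [tendsto_pi_nhds]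
    intro x
    simpa [gR, Finset.mul_sum] using hR x
  refine ⟨⟨(continuousLinearMapOfTendsto gL hgL, continuousLinearMapOfTendsto gR hgR), ?_⟩,
    ⟨hL, hR⟩⟩
  intro x y
  refine tendsto_nhds_unique ((hR x).mul_const y) ?_
  refine ((hL y).const_mul x).congr fun N => ?_
  simp only [Finset.mul_sum, Finset.sum_mul, mul_assoc]

end StrictlyOrthogonal

namespace IsStrictSum

variable {s t : ℕ → A} {S T : 𝓜(ℂ, A)}

theorem unique (hS : IsStrictSum t S) (hT : IsStrictSum t T) : S = T :=
  DoubleCentralizer.ext _ _ _ _ <| Prod.ext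
    (ContinuousLinearMap.ext fun x => tendsto_nhds_unique (hS.left x) (hT.left x))
    (ContinuousLinearMap.ext fun x => tendsto_nhds_unique (hS.right x) (hT.right x))

theorem zero : IsStrictSum (fun _ => (0 : A)) 0 := ⟨fun x => by simp, fun x => by simp⟩

theorem add (hS : IsStrictSum s S) (hT : IsStrictSum t T) :
    IsStrictSum (fun i => s i + t i) (S + T) :=
  ⟨fun x => by simpa [add_mul, Finset.sum_add_distrib] using (hS.left x).add (hT.left x),
    fun x => by simpa [mul_add, Finset.sum_add_distrib] using (hS.right x).add (hT.right x)⟩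

theorem sub (hS : IsStrictSum s S) (hT : IsStrictSum t T) :
    IsStrictSum (fun i => s i - t i) (S - T) :=
  ⟨fun x => by simpa [sub_mul, Finset.sum_sub_distrib] using (hS.left x).sub (hT.left x),
    fun x => by simpa [mul_sub, Finset.sum_sub_distrib] using (hS.right x).sub (hT.right x)⟩

theorem smul (c : ℂ) (hT : IsStrictSum t T) : IsStrictSum (fun i => c • t i) (c • T) :=
  ⟨fun x => by simpa [smul_mul_assoc, Finset.smul_sum] using (hT.left x).const_smul c,
    fun x => by simpa [mul_smul_comm, Finset.smul_sum] using (hT.right x).const_smul c⟩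

theorem sum {ι : Type*} (F : Finset ι) {t : ι → ℕ → A} {T : ι → 𝓜(ℂ, A)}
    (h : ∀ j ∈ F, IsStrictSum (t j) (T j)) :
    IsStrictSum (fun i => ∑ j ∈ F, t j i) (∑ j ∈ F, T j) := by
  classical
  induction F using Finset.induction with
  | empty => simpa using zero
  | insert j F hj ih =>
    simp only [Finset.sum_insert hj]
    exact (h j (by simp)).add (ih fun k hk => h k (by simp [hk]))

theorem star (hT : IsStrictSum t T) : IsStrictSum (fun i => star (t i)) (star T) :=
  ⟨fun x => by simpa [star_sum] using (hT.right (Star.star x)).star,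
    fun x => by simpa [star_sum] using (hT.left (Star.star x)).star⟩

theorem isSelfAdjoint (hT : IsStrictSum t T) (h : ∀ i, IsSelfAdjoint (t i)) : IsSelfAdjoint T := by
  have := hT.star
  simp only [fun i => (h i).star_eq] at this
  exact this.unique hT

theorem fst_apply (hT : IsStrictSum t T) {j : ℕ} {x : A} (h : ∀ i, i ≠ j → t i * x = 0) :
    T.fst x = t j * x := by
  refine tendsto_nhds_unique (hT.left x) (tendsto_const_nhds.congr' ?_)
  filter_upwards [eventually_gt_atTop j] with N hN
  exact (Finset.sum_eq_single_of_mem j (Finset.mem_range.2 hN) fun i _ hi => h i hi).symm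

theorem snd_apply (hT : IsStrictSum t T) {j : ℕ} {x : A} (h : ∀ i, i ≠ j → x * t i = 0) :
    T.snd x = x * t j := by
  refine tendsto_nhds_unique (hT.right x) (tendsto_const_nhds.congr' ?_)
  filter_upwards [eventually_gt_atTop j] with N hN
  exact (Finset.sum_eq_single_of_mem j (Finset.mem_range.2 hN) fun i _ hi => h i hi).symm

theorem mul (hS : IsStrictSum s S) (hT : IsStrictSum t T) (h : ∀ i j, i ≠ j → s i * t j = 0) :
    IsStrictSum (fun i => s i * t i) (S * T) := by
  constructor
  · intro x
    have := (S.fst.continuous.tendsto _).comp (hT.left x)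
    refine this.congr fun N => ?_
    rw [Function.comp_apply, map_sum]
    refine Finset.sum_congr rfl fun j _ => ?_
    rw [hS.fst_apply (j := j) fun i hi => by rw [← mul_assoc, h i j hi, zero_mul], mul_assoc]
  · intro x
    have := (T.snd.continuous.tendsto _).comp (hS.right x)
    refine this.congr fun N => ?_
    rw [Function.comp_apply, map_sum]
    refine Finset.sum_congr rfl fun j _ => ?_
    rw [hT.snd_apply (j := j) fun i hi => by rw [mul_assoc, h j i hi.symm, mul_zero], mul_assoc]

theorem norm_le {a : ℕ → A} (ha : StrictlyOrthogonal a) (hT : IsStrictSum t T) {C : ℝ}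
    (hC : 0 ≤ C) (hb : ∀ i, ‖t i‖ ≤ C) (ht : ∀ i, SupportedBy (a i) (t i)) : ‖T‖ ≤ C := by
  rw [← DoubleCentralizer.norm_fst]
  refine ContinuousLinearMap.opNorm_le_bound _ hC fun x =>
    le_of_tendsto (hT.left x).norm (Eventually.of_forall fun N => ?_)
  rw [← Finset.sum_mul]
  exact (norm_mul_le _ _).trans
    (mul_le_mul_of_nonneg_right (ha.norm_sum_le hC hb ht _) (norm_nonneg _))

end IsStrictSum

section FunctionalCalculus

theorem fst_mul_apply (T : 𝓜(ℂ, A)) (x y : A) : T.fst (x * y) = T.fst x * y := by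
  rw [← sub_eq_zero, ← CStarRing.star_mul_self_eq_zero_iff]
  have h : ∀ z : A, z * (T.fst (x * y) - T.fst x * y) = 0 := fun z => by
    rw [mul_sub, ← T.central, ← mul_assoc, ← mul_assoc, ← T.central, sub_self]
  exact h _

theorem cfc_mul_eq_mul_cfc {M : Type*} [CStarAlgebra M] {f : ℝ → ℝ} (hf : Continuous f)
    {D a x : M} (hD : IsSelfAdjoint D) (ha : IsSelfAdjoint a) (h : D * x = x * a) :
    cfc f D * x = x * cfc f a := by
  have hpoly : ∀ p : Polynomial ℝ, Polynomial.aeval D p * x = x * Polynomial.aeval a p := by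
    intro p
    induction p using Polynomial.induction_on' with
    | add p q hp hq => simp only [map_add, add_mul, mul_add, hp, hq]
    | monomial n r =>
      have : SemiconjBy x (a ^ n) (D ^ n) :=
        SemiconjBy.pow_right (show x * a = D * x from h.symm) n
      simp only [Polynomial.aeval_monomial]
      rw [mul_assoc, ← this.eq, ← mul_assoc, ← mul_assoc, Algebra.commutes]
  obtain ⟨K, hK, hKD, hKa⟩ : ∃ K : ℝ, 0 ≤ K ∧ (∀ t ∈ spectrum ℝ D, t ∈ Set.Icc (-K) K) ∧
      ∀ t ∈ spectrum ℝ a, t ∈ Set.Icc (-K) K := by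
    cases subsingleton_or_nontrivial M
    · exact ⟨0, le_rfl, by simp, by simp⟩
    · refine ⟨max ‖D‖ ‖a‖, by positivity, fun t ht => ?_, fun t ht => ?_⟩
      · exact abs_le.1 ((spectrum.norm_le_norm_of_mem ht).trans (le_max_left _ _))
      · exact abs_le.1 ((spectrum.norm_le_norm_of_mem ht).trans (le_max_right _ _))
  rw [← sub_eq_zero, ← norm_le_zero_iff]
  refine le_of_forall_pos_le_add fun ε hε => ?_
  obtain ⟨p, hp⟩ := exists_polynomial_near_of_continuousOn (-K) K f hf.continuousOn
    (ε / (2 * (‖x‖ + 1))) (by positivity)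
  have hb : ∀ b : M, IsSelfAdjoint b → (∀ t ∈ spectrum ℝ b, t ∈ Set.Icc (-K) K) →
      ‖cfc f b - Polynomial.aeval b p‖ ≤ ε / (2 * (‖x‖ + 1)) := by
    intro b hb hs
    rw [← cfc_polynomial p b hb, ← cfc_sub f p.eval b hf.continuousOn p.continuousOn]
    refine norm_cfc_le (by positivity) fun t ht => ?_
    rw [Real.norm_eq_abs, abs_sub_comm]
    exact (hp t (hs t ht)).le
  have heq : cfc f D * x - x * cfc f a =
      (cfc f D - Polynomial.aeval D p) * x - x * (cfc f a - Polynomial.aeval a p) := by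
    rw [sub_mul, mul_sub, hpoly]
    abel
  rw [heq, zero_add]
  calc _ ≤ ε / (2 * (‖x‖ + 1)) * ‖x‖ + ‖x‖ * (ε / (2 * (‖x‖ + 1))) := by
        refine (norm_sub_le _ _).trans (add_le_add ((norm_mul_le _ _).trans ?_)
          ((norm_mul_le _ _).trans ?_))
        · exact mul_le_mul_of_nonneg_right (hb D hD hKD) (norm_nonneg _)
        · exact mul_le_mul_of_nonneg_left (hb a ha hKa) (norm_nonneg _)
    _ ≤ ε := by
        have : ‖x‖ * (ε / (2 * (‖x‖ + 1))) ≤ ε / 2 := by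
          rw [mul_div_assoc', div_le_div_iff₀ (by positivity) (by positivity)]
          nlinarith [norm_nonneg x]
        linarith

theorem cfcₙ_eq_mul_cfc {M : Type*} [CStarAlgebra M] {ρ κ : ℝ → ℝ} (hκ : Continuous κ)
    (hρ : ∀ t, ρ t = t * κ t) {D : M} (hD : IsSelfAdjoint D) :
    cfcₙ ρ D = cfc κ D * D ∧ cfcₙ ρ D = D * cfc κ D := by
  obtain rfl : ρ = fun t => t * κ t := funext hρ
  have h : cfcₙ (fun t => t * κ t) D = D * cfc κ D := by
    rw [cfcₙ_eq_cfc (hf := by fun_prop) (hf0 := by simp),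
      cfc_mul (fun t => t) κ D (by fun_prop) (by fun_prop), cfc_id' ℝ D]
  have hc := (cfc_commute_cfc (fun t : ℝ => t) κ D).eq
  rw [cfc_id' ℝ D] at hc
  exact ⟨h.trans hc, h⟩

theorem continuous_of_nonUnitalStarAlgHom {B C : Type*} [NonUnitalCStarAlgebra B]
    [NonUnitalCStarAlgebra C] (φ : B →⋆ₙₐ[ℂ] C) : Continuous φ :=
  AddMonoidHomClass.continuous_of_bound φ 1 fun x => by
    simpa using NonUnitalStarAlgHom.norm_apply_le φ x

theorem coe_cfcₙ {ρ : ℝ → ℝ} (hρ : Continuous ρ) (h0 : ρ 0 = 0) {a : A} (ha : IsSelfAdjoint a) :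
    ((cfcₙ ρ a : A) : 𝓜(ℂ, A)) = cfcₙ ρ (a : 𝓜(ℂ, A)) :=
  NonUnitalStarAlgHom.map_cfcₙ (S := ℂ) (DoubleCentralizer.coeHom (𝕜 := ℂ) (A := A)) ρ a
    (by fun_prop) h0 (continuous_of_nonUnitalStarAlgHom _) ha (ha.map _)

theorem multiplierCoe_mul (x y : A) : ((x * y : A) : 𝓜(ℂ, A)) = (x : 𝓜(ℂ, A)) * y :=
  map_mul (DoubleCentralizer.coeHom (𝕜 := ℂ) (A := A)) x y

theorem mul_multiplierCoe (T : 𝓜(ℂ, A)) (x : A) : T * (x : 𝓜(ℂ, A)) = (T.fst x : A) := by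
  refine DoubleCentralizer.ext _ _ _ _ (Prod.ext ?_ ?_) <;> ext y
  · change T.fst (x * y) = T.fst x * y
    exact fst_mul_apply T x y
  · change T.snd y * x = y * T.fst x
    exact T.central y x

theorem multiplierCoe_injective : Function.Injective ((↑) : A → 𝓜(ℂ, A)) := by
  intro x y h
  have hz : ∀ z : A, x * z = y * z := fun z => by
    have := congrArg (fun T : 𝓜(ℂ, A) => T.fst z) h
    simpa using this
  rw [← sub_eq_zero, ← CStarRing.mul_star_self_eq_zero_iff, sub_mul, hz, sub_self]

theorem supportedBy_cfcₙ {ρ κ : ℝ → ℝ} (hκ : Continuous κ) (hρ : ∀ t, ρ t = t * κ t) {a : A}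
    (ha : IsSelfAdjoint a) : SupportedBy a (cfcₙ ρ a) := by
  have hρc : Continuous ρ := by rw [funext hρ]; fun_prop
  obtain ⟨h₁, h₂⟩ := cfcₙ_eq_mul_cfc hκ hρ
    (ha.map (DoubleCentralizer.coeHom (𝕜 := ℂ) (A := A)))
  have hc := coe_cfcₙ hρc (by simp [hρ]) ha
  have h0 : ((0 : A) : 𝓜(ℂ, A)) = 0 := map_zero (DoubleCentralizer.coeHom (𝕜 := ℂ) (A := A))
  constructor <;> intro x hx <;> apply multiplierCoe_injective
  · rw [multiplierCoe_mul, hc]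
    refine (congrArg (· * (x : 𝓜(ℂ, A))) h₁).trans ?_
    change _ * (a : 𝓜(ℂ, A)) * (x : 𝓜(ℂ, A)) = _
    rw [mul_assoc, ← multiplierCoe_mul, hx, h0, mul_zero]
  · rw [multiplierCoe_mul, hc]
    refine (congrArg ((x : 𝓜(ℂ, A)) * ·) h₂).trans ?_
    change _ * ((a : 𝓜(ℂ, A)) * _) = _
    rw [← mul_assoc, ← multiplierCoe_mul, hx, h0, zero_mul]

theorem IsStrictSum.cfcₙ {a : ℕ → A} (ha : StrictlyOrthogonal a) {D : 𝓜(ℂ, A)}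
    (hD : IsStrictSum a D) {ρ κ : ℝ → ℝ} (hκ : Continuous κ) (hρ : ∀ t, ρ t = t * κ t) :
    IsStrictSum (fun i => _root_.cfcₙ ρ (a i)) (_root_.cfcₙ ρ D) := by
  have hρc : Continuous ρ := by rw [funext hρ]; fun_prop
  have hDs : IsSelfAdjoint D := hD.isSelfAdjoint ha.selfAdjoint
  have hcoe : ∀ i, IsSelfAdjoint (a i : 𝓜(ℂ, A)) := fun i =>
    (ha.selfAdjoint i).map (DoubleCentralizer.coeHom (𝕜 := ℂ) (A := A))
  have hKa : ∀ i, (cfc κ D).fst (a i) = _root_.cfcₙ ρ (a i) := by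
    intro i
    apply multiplierCoe_injective
    rw [← mul_multiplierCoe, coe_cfcₙ hρc (by simp [hρ]) (ha.selfAdjoint i),
      (cfcₙ_eq_mul_cfc hκ hρ (hcoe i)).2]
    refine cfc_mul_eq_mul_cfc hκ hDs (hcoe i) ?_
    rw [mul_multiplierCoe, hD.fst_apply (j := i) fun j hj => ha.orth j i hj, multiplierCoe_mul]
  have hleft : ∀ x, Tendsto (fun N => ∑ i ∈ Finset.range N, _root_.cfcₙ ρ (a i) * x) atTop
      (𝓝 ((_root_.cfcₙ ρ D).fst x)) := by
    intro x
    rw [(cfcₙ_eq_mul_cfc hκ hρ hDs).1]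
    refine (((cfc κ D).fst.continuous.tendsto _).comp (hD.left x)).congr fun N => ?_
    rw [Function.comp_apply, map_sum]
    refine Finset.sum_congr rfl fun i _ => ?_
    rw [← hKa i, fst_mul_apply]
  refine ⟨hleft, fun x => ?_⟩
  have hs : Star.star (_root_.cfcₙ ρ D) = _root_.cfcₙ ρ D := (cfcₙ_predicate ρ D).star_eq
  have hsi : ∀ i, Star.star (_root_.cfcₙ ρ (a i)) = _root_.cfcₙ ρ (a i) := fun i =>
    (cfcₙ_predicate ρ (a i)).star_eq
  have := (hleft (Star.star x)).star
  rw [← hs]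
  simpa [star_sum, hsi] using this

end FunctionalCalculus

end StrictSums

section Positive

attribute [local instance] CStarAlgebra.spectralOrder CStarAlgebra.spectralOrderedRing

variable {B : Type*} [NonUnitalCStarAlgebra B]

theorem cstarNonneg_iff_nonneg {a : B} : CStarNonneg a ↔ 0 ≤ a :=
  CStarAlgebra.nonneg_iff_eq_star_mul_self.symm

theorem CStarNonneg.isSelfAdjoint {a : B} (ha : CStarNonneg a) : IsSelfAdjoint a := by
  obtain ⟨b, rfl⟩ := ha
  exact IsSelfAdjoint.star_mul_self b

theorem CStarNonneg.zero : CStarNonneg (0 : B) := ⟨0, by simp⟩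

theorem CStarNonneg.add {a b : B} (ha : CStarNonneg a) (hb : CStarNonneg b) :
    CStarNonneg (a + b) :=
  cstarNonneg_iff_nonneg.2 (add_nonneg (cstarNonneg_iff_nonneg.1 ha) (cstarNonneg_iff_nonneg.1 hb))

theorem CStarNonneg.sum {ι : Type*} (s : Finset ι) {a : ι → B} (h : ∀ i ∈ s, CStarNonneg (a i)) :
    CStarNonneg (∑ i ∈ s, a i) :=
  Finset.sum_induction a CStarNonneg (fun _ _ => CStarNonneg.add) CStarNonneg.zero h

theorem CStarNonneg.conj {a : B} (ha : CStarNonneg a) (r : B) : CStarNonneg (r * a * star r) := by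
  obtain ⟨b, rfl⟩ := ha
  exact ⟨b * star r, by simp [mul_assoc]⟩

theorem CStarNonneg.map {C : Type*} [NonUnitalCStarAlgebra C] (φ : B →⋆ₙₐ[ℂ] C) {a : B}
    (ha : CStarNonneg a) : CStarNonneg (φ a) := by
  obtain ⟨b, rfl⟩ := ha
  exact ⟨φ b, by rw [map_mul, map_star]⟩

theorem CStarNonneg.of_map {C : Type*} [NonUnitalCStarAlgebra C] (φ : B →⋆ₙₐ[ℂ] C)
    (hφ : Function.Injective φ) {a : B} (ha : CStarNonneg (φ a)) : CStarNonneg a := by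
  have hs : IsSelfAdjoint a := hφ (by rw [map_star, ha.isSelfAdjoint.star_eq])
  rw [cstarNonneg_iff_nonneg, ← CFC.negPart_eq_zero_iff a hs]
  apply hφ
  rw [map_zero, CFC.negPart_def, NonUnitalStarAlgHom.map_cfcₙ (S := ℂ) φ (·⁻ : ℝ → ℝ) a
    (by fun_prop) (by simp) (continuous_of_nonUnitalStarAlgHom φ) hs ha.isSelfAdjoint,
    ← CFC.negPart_def, CFC.negPart_eq_zero_iff _ ha.isSelfAdjoint]
  exact cstarNonneg_iff_nonneg.1 ha

theorem cstarNonneg_mul_star_self (a : B) : CStarNonneg (a * star a) := ⟨star a, by simp⟩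

theorem CStarNonneg.norm_le_norm_sum {ι : Type*} {s : Finset ι} {a : ι → B}
    (h : ∀ i ∈ s, CStarNonneg (a i)) {j : ι} (hj : j ∈ s) : ‖a j‖ ≤ ‖∑ i ∈ s, a i‖ :=
  CStarAlgebra.norm_le_norm_of_nonneg_of_le (cstarNonneg_iff_nonneg.1 (h j hj))
    (Finset.single_le_sum (fun i hi => cstarNonneg_iff_nonneg.1 (h i hi)) hj)

theorem CStarNonneg.cutdown {a : B} (ε : ℝ) :
    CStarNonneg (cfcₙ (fun t : ℝ => max (t - ε) 0) a) :=
  cstarNonneg_iff_nonneg.2 (cfcₙ_nonneg fun _ _ => le_max_right _ _)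

theorem CStarNonneg.norm_sub_cutdown_le {a : B} (ha : CStarNonneg a) {ε : ℝ} (hε : 0 < ε) :
    ‖a - cfcₙ (fun t : ℝ => max (t - ε) 0) a‖ ≤ ε := by
  have h0 : max ((0 : ℝ) - ε) 0 = 0 := max_eq_right (by linarith)
  have hs := ha.isSelfAdjoint
  have : a - cfcₙ (fun t : ℝ => max (t - ε) 0) a =
      cfcₙ (fun t : ℝ => t - max (t - ε) 0) a := by
    rw [cfcₙ_sub (fun t : ℝ => t) (fun t : ℝ => max (t - ε) 0) a (by fun_prop) rfl
      (by fun_prop) h0, cfcₙ_id' ℝ a]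
  rw [this]
  refine norm_cfcₙ_le fun t ht => ?_
  have ht0 : 0 ≤ t := quasispectrum_nonneg_of_nonneg a (cstarNonneg_iff_nonneg.1 ha) t ht
  rw [Real.norm_eq_abs, abs_le]
  constructor <;> rcases le_total (t - ε) 0 with h | h
  · rw [max_eq_right h]; linarith
  · rw [max_eq_left h]; linarith
  · rw [max_eq_right h]; linarith
  · rw [max_eq_left h]; linarith

theorem CuntzBelow.conj (a r : B) : CuntzBelow (r * a * star r) a := ⟨fun _ => r, tendsto_const_nhds⟩

theorem CuntzBelow.exists_norm_lt {a b : B} (h : CuntzBelow a b) {ε : ℝ} (hε : 0 < ε) :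
    ∃ r, ‖a - r * b * star r‖ < ε := by
  obtain ⟨r, hr⟩ := h
  obtain ⟨N, hN⟩ := Metric.tendsto_atTop.1 hr ε hε
  exact ⟨r N, by rw [← dist_eq_norm, dist_comm]; exact hN N le_rfl⟩

end Positive

namespace CuSemigroup

variable {S : Type*} [CuSemigroup S]

theorem add_le_add_of_le {a b c d : S} (h₁ : a ≤ b) (h₂ : c ≤ d) : a + c ≤ b + d :=
  (add_le_add' c d h₂ a).trans (by rw [add_comm a, add_comm b]; exact add_le_add' a b h₁ d)

theorem nsmul_le_nsmul_of_le {a b : S} (h : a ≤ b) (n : ℕ) : n • a ≤ n • b := by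
  induction n with
  | zero => simp
  | succ n ih => rw [succ_nsmul, succ_nsmul]; exact add_le_add_of_le ih h

theorem le_nsmul_self (a : S) {n : ℕ} (hn : 1 ≤ n) : a ≤ n • a := by
  obtain ⟨k, rfl⟩ := Nat.exists_eq_add_of_le hn
  rw [add_nsmul, one_nsmul]
  simpa using add_le_add' 0 (k • a) (zero_le' _) a

theorem wayBelow_nsmul {a b : S} (h : WayBelow a b) (n : ℕ) : WayBelow (n • a) (n • b) := by
  induction n with
  | zero => exact fun f _ s _ _ => ⟨0, by rw [zero_nsmul]; exact zero_le' _⟩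
  | succ n ih => rw [succ_nsmul, succ_nsmul]; exact waybelow_add ih h

end CuSemigroup

namespace IsCuntzSemigroupOf

variable {A : Type*} [NonUnitalCStarAlgebra A] {S : Type*} [CuSemigroup S]
  (h : IsCuntzSemigroupOf A S)

/-- The canonical corner embedding of `A` into its stabilization. -/
def corner : A →⋆ₙₐ[ℂ] h.stab where
  toFun x := h.matEmb 1 (Matrix.of fun _ _ => x)
  map_smul' c x := by
    rw [MonoidHom.id_apply, ← map_smul]
    rfl
  map_zero' := map_zero (h.matEmb 1)
  map_add' x y := by
    rw [← map_add]
    rfl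
  map_mul' x y := by
    rw [← map_mul]
    congr 1
    ext i j
    simp [Matrix.mul_apply]
  map_star' x := by
    rw [← map_star]
    rfl

theorem corner_injective : Function.Injective h.corner := fun x y hxy => by
  have := h.matEmb_injective 1 hxy
  exact congrFun (congrFun this 0) 0

/-- The matrix with single entry `x`, viewed in the stabilization. -/
def entry {N : ℕ} (k l : Fin N) (x : A) : h.stab := h.matEmb N (Matrix.single k l x)

variable {N : ℕ}

theorem entry_mul (k l l' : Fin N) (x y : A) :
    h.entry k l x * h.entry l l' y = h.entry k l' (x * y) := by
  rw [entry, entry, ← map_mul, Matrix.single_mul_single_same, entry]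

theorem entry_mul_of_ne (k l l₁ l' : Fin N) (hl : l ≠ l₁) (x y : A) :
    h.entry k l x * h.entry l₁ l' y = 0 := by
  rw [entry, entry, ← map_mul, Matrix.single_mul_single_of_ne _ _ _ _ hl, map_zero]

theorem star_entry (k l : Fin N) (x : A) : star (h.entry k l x) = h.entry l k (star x) := by
  rw [entry, ← map_star, entry, Matrix.star_eq_conjTranspose, Matrix.conjTranspose_single]

theorem matPad_single (k l : Fin N) (x : A) :
    matPad (Matrix.single k l x) = Matrix.single k.castSucc l.castSucc x := by
  ext i j
  simp only [matPad, Matrix.of_apply, Matrix.single_apply, Fin.ext_iff, Fin.val_castSucc]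
  split_ifs <;> first | rfl | omega

theorem entry_castLE {M : ℕ} (hM : N ≤ M) (k l : Fin N) (x : A) :
    h.entry (k.castLE hM) (l.castLE hM) x = h.entry k l x := by
  induction M, hM using Nat.le_induction with
  | base => rfl
  | succ M hM ih =>
    rw [← ih, entry, entry, ← h.matEmb_compat M, matPad_single]
    rfl

theorem entry_zero_zero [NeZero N] (x : A) : h.entry (0 : Fin N) 0 x = h.corner x := by
  have := h.entry_castLE (N := 1) (M := N) (Nat.one_le_iff_ne_zero.2 (NeZero.ne N)) 0 0 x
  have h0 : (0 : Fin 1).castLE (Nat.one_le_iff_ne_zero.2 (NeZero.ne N)) = (0 : Fin N) := by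
    ext; simp
  rw [h0] at this
  rw [this, entry]
  change _ = h.matEmb 1 _
  congr 1
  ext i j
  simp [Subsingleton.elim i 0, Subsingleton.elim j 0]

theorem range_matEmb_mono {M : ℕ} (hM : N ≤ M) :
    Set.range (h.matEmb N) ⊆ Set.range (h.matEmb M) := by
  induction M, hM using Nat.le_induction with
  | base => rfl
  | succ M hM ih =>
    refine ih.trans ?_
    rintro _ ⟨x, rfl⟩
    exact ⟨matPad x, h.matEmb_compat M x⟩

theorem entry_mul_mul_entry_mem [NeZero N] (k l : Fin N) (x y : A) (z : h.stab) :
    ∃ t, h.corner t = h.entry 0 k x * z * h.entry l 0 y := by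
  change h.entry 0 k x * z * h.entry l 0 y ∈ Set.range h.corner
  have hcl : IsClosed (Set.range h.corner) :=
    (NonUnitalStarAlgHom.isometry h.corner h.corner_injective).isClosedEmbedding.isClosed_range
  have hcl' : IsClosed {z | h.entry 0 k x * z * h.entry l 0 y ∈ Set.range h.corner} :=
    hcl.preimage (by fun_prop)
  refine hcl'.closure_subset_iff.2 ?_ (h.matEmb_dense z)
  rintro z hz
  obtain ⟨n, hn⟩ := Set.mem_iUnion.1 hz
  have hM : N ≤ max N n := le_max_left _ _
  obtain ⟨z, rfl⟩ := h.range_matEmb_mono (le_max_right N n) hn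
  have : NeZero (max N n) := ⟨fun h0 => NeZero.ne N (by omega)⟩
  have h0 : (0 : Fin N).castLE hM = 0 := by ext; simp
  refine ⟨x * z (k.castLE hM) (l.castLE hM) * y, ?_⟩
  rw [← h.entry_castLE hM, ← h.entry_castLE hM, h0, ← h.entry_zero_zero (N := max N n), entry,
    entry, entry, ← map_mul, ← map_mul]
  rw [Matrix.single_mul_mul_single]

theorem cstarNonneg_entry (k : Fin N) {x : A} (hx : CStarNonneg x) :
    CStarNonneg (h.entry k k x) := by
  obtain ⟨b, rfl⟩ := hx
  exact ⟨h.entry k k b, by rw [star_entry, entry_mul]⟩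

theorem cls_conj_le {a : h.stab} (ha : CStarNonneg a) (r : h.stab) :
    h.cls (r * a * star r) ≤ h.cls a :=
  (h.cls_le_iff _ _ (ha.conj r) ha).2 (CuntzBelow.conj a r)

theorem cls_entry [NeZero N] (k : Fin N) {b g : A} (hb : CStarNonneg b) (hg : IsSelfAdjoint g)
    (hgb : g * b = b) (hbg : b * g = b) : h.cls (h.entry k k b) = h.cls (h.corner b) := by
  have key : ∀ i j : Fin N, h.cls (h.entry i i b) ≤ h.cls (h.entry j j b) := fun i j => by
    have := h.cls_conj_le (h.cstarNonneg_entry j hb) (h.entry i j g)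
    rwa [star_entry, entry_mul, entry_mul, hg.star_eq, hgb, hbg] at this
  rw [← h.entry_zero_zero (N := N)]
  exact le_antisymm (key _ _) (key _ _)

theorem cls_sum_entry [NeZero N] (s : Finset (Fin N)) {b g : A} (hb : CStarNonneg b)
    (hg : IsSelfAdjoint g) (hgb : g * b = b) (hbg : b * g = b) :
    h.cls (∑ k ∈ s, h.entry k k b) = s.card • h.cls (h.corner b) := by
  induction s using Finset.induction with
  | empty => simp [h.cls_zero]
  | insert k s hk ih =>
    rw [Finset.sum_insert hk, Finset.card_insert_of_notMem hk, succ_nsmul', ← ih,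
      ← h.cls_entry k hb hg hgb hbg]
    refine h.cls_add_orth _ _ (h.cstarNonneg_entry k hb)
      (CStarNonneg.sum _ fun i _ => h.cstarNonneg_entry i hb) ?_
    rw [Finset.mul_sum]
    exact Finset.sum_eq_zero fun i hi =>
      h.entry_mul_of_ne _ _ _ _ (by rintro rfl; exact hk hi) _ _

theorem exists_sum_near (n : ℕ) (y : Fin n → S) {a : h.stab} (ha : CStarNonneg a)
    (hay : h.cls a ≤ ∑ j, y j) {ε : ℝ} (hε : 0 < ε) :
    ∃ w : Fin n → h.stab, (∀ j, CStarNonneg (w j)) ∧ (∀ j, h.cls (w j) ≤ y j) ∧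
      ‖a - ∑ j, w j‖ < ε := by
  induction n generalizing a ε with
  | zero =>
    rw [Fin.sum_univ_zero, ← h.cls_zero, h.cls_le_iff _ _ ha CStarNonneg.zero] at hay
    obtain ⟨r, hr⟩ := hay.exists_norm_lt hε
    exact ⟨Fin.elim0, fun j => j.elim0, fun j => j.elim0, by simpa using hr⟩
  | succ n ih =>
    obtain ⟨c₀, hc₀, hcy₀⟩ := h.cls_surj (y 0)
    obtain ⟨c₁, hc₁, hcy₁⟩ := h.cls_surj (∑ j : Fin n, y j.succ)
    obtain ⟨d₀, d₁, hd₀, hd₁, hd, hdc₀, hdc₁⟩ := h.exists_orth c₀ c₁ hc₀ hc₁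
    rw [Fin.sum_univ_succ, ← hcy₀, ← hcy₁, ← hdc₀, ← hdc₁, ← h.cls_add_orth _ _ hd₀ hd₁ hd,
      h.cls_le_iff _ _ ha (hd₀.add hd₁)] at hay
    obtain ⟨r, hr⟩ := hay.exists_norm_lt (half_pos hε)
    obtain ⟨w, hw, hwy, hwn⟩ := ih (fun j => y j.succ) (hd₁.conj r)
      ((h.cls_conj_le hd₁ r).trans (hdc₁.trans hcy₁).le) (half_pos hε)
    refine ⟨Fin.cons (r * d₀ * star r) w, Fin.cases (hd₀.conj r) hw,
      Fin.cases ((h.cls_conj_le hd₀ r).trans (hdc₀.trans hcy₀).le) hwy, ?_⟩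
    rw [Fin.sum_univ_succ]
    simp only [Fin.cons_zero, Fin.cons_succ]
    have : a - (r * d₀ * star r + ∑ j, w j) =
        (a - r * (d₀ + d₁) * star r) + (r * d₁ * star r - ∑ j, w j) := by
      rw [mul_add, add_mul]
      abel
    rw [this]
    calc _ ≤ _ := norm_add_le _ _
      _ < ε / 2 + ε / 2 := add_lt_add hr hwn
      _ = ε := add_halves ε

theorem norm_entry_zero_le [NeZero N] (k : Fin N) {g : A} (hg : IsSelfAdjoint g)
    (hg1 : ‖g‖ ≤ 1) : ‖h.entry 0 k g‖ ≤ 1 ∧ ‖h.entry k 0 g‖ ≤ 1 := by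
  have h₁ : ‖h.entry 0 k g‖ ≤ 1 := by
    have : ‖h.entry 0 k g‖ * ‖h.entry 0 k g‖ ≤ 1 := by
      rw [← CStarRing.norm_self_mul_star, star_entry, entry_mul, hg.star_eq, entry_zero_zero,
        NonUnitalStarAlgHom.norm_map h.corner h.corner_injective]
      exact (norm_mul_le _ _).trans (mul_le_one₀ hg1 (norm_nonneg _) hg1)
    nlinarith [norm_nonneg (h.entry 0 k g)]
  refine ⟨h₁, ?_⟩
  rwa [← norm_star, star_entry, hg.star_eq]

/-- If `2m•[w] ≤ m•[b]`, with `w` and `b = β²` having local units, then the comparison is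
approximately implemented by a `2m × m` matrix over `A`. -/
theorem exists_matrix_near {m : ℕ} (hm : 1 ≤ m) {β g p w : A} (hβ : IsSelfAdjoint β)
    (hg : IsSelfAdjoint g) (hp : IsSelfAdjoint p) (hg1 : ‖g‖ ≤ 1) (hgβ : g * β = β)
    (hpg : p * g = g) (hw : CStarNonneg w) (hgw : g * w = w)
    (hle : (2 * m) • h.cls (h.corner w) ≤ m • h.cls (h.corner (β * β))) {ε : ℝ} (hε : 0 < ε) :
    ∃ s : Fin (2 * m) → Fin m → A, (∀ k l, p * s k l = s k l ∧ s k l * p = s k l) ∧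
      ∀ k k', ‖∑ l, s k l * star (s k' l) - if k = k' then w else 0‖ ≤ ε := by
  have : NeZero (2 * m) := ⟨by omega⟩
  have hβg : β * g = β := by simpa [hβ.star_eq, hg.star_eq] using congrArg star hgβ
  have hwg : w * g = w := by simpa [hw.isSelfAdjoint.star_eq, hg.star_eq] using congrArg star hgw
  have hgp : g * p = g := by simpa [hp.star_eq, hg.star_eq] using congrArg star hpg
  have hβp : β * p = β := by rw [← hβg, mul_assoc, hgp]
  have hb : CStarNonneg (β * β) := ⟨β, by rw [hβ.star_eq]⟩
  have hmm : m ≤ 2 * m := by omega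
  set s₀ : Finset (Fin (2 * m)) := Finset.univ.map (Fin.castLEEmb hmm) with hs₀
  have hcard : s₀.card = m := by simp [hs₀]
  have hle' : h.cls (∑ k : Fin (2 * m), h.entry k k w) ≤
      h.cls (∑ l ∈ s₀, h.entry l l (β * β)) := by
    rw [h.cls_sum_entry _ hw hg hgw hwg, h.cls_sum_entry _ hb hg (by rw [← mul_assoc, hgβ])
      (by rw [mul_assoc, hβg]), hcard, Finset.card_univ, Fintype.card_fin]
    exact hle
  rw [h.cls_le_iff _ _ (CStarNonneg.sum _ fun i _ => h.cstarNonneg_entry i hw)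
    (CStarNonneg.sum _ fun i _ => h.cstarNonneg_entry i hb)] at hle'
  obtain ⟨r, hr⟩ := hle'.exists_norm_lt hε
  choose t ht using fun (k : Fin (2 * m)) (l : Fin m) =>
    h.entry_mul_mul_entry_mem k (l.castLE hmm) g g r
  refine ⟨fun k l => t k l * β, fun k l => ⟨?_, ?_⟩, fun k k' => ?_⟩
  · rw [← mul_assoc]
    congr 1
    apply h.corner_injective
    rw [map_mul, ht, ← h.entry_zero_zero (N := 2 * m), ← mul_assoc, ← mul_assoc, entry_mul, hpg]
  · rw [mul_assoc, hβp]
  · have hw' : h.entry 0 k g * (∑ i : Fin (2 * m), h.entry i i w) * h.entry k' 0 g =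
        h.corner (if k = k' then w else 0) := by
      rw [Finset.mul_sum, Finset.sum_mul, Finset.sum_eq_single_of_mem k (Finset.mem_univ k)]
      · rw [entry_mul, hgw]
        split_ifs with hk
        · rw [← hk, entry_mul, hwg, entry_zero_zero]
        · rw [entry_mul_of_ne _ _ _ _ _ hk, map_zero]
      · intro i _ hi
        rw [entry_mul_of_ne _ _ _ _ _ hi.symm, zero_mul]
    have hb' : h.entry 0 k g * (r * (∑ l ∈ s₀, h.entry l l (β * β)) * star r) * h.entry k' 0 g =
        h.corner (∑ l, t k l * β * star (t k' l * β)) := by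
      rw [hs₀, Finset.sum_map, map_sum]
      simp only [Finset.mul_sum, Finset.sum_mul]
      refine Finset.sum_congr rfl fun l _ => ?_
      have hbl : h.entry (l.castLE hmm) (l.castLE hmm) (β * β) =
          h.entry (l.castLE hmm) 0 g * h.corner β * h.corner β *
            h.entry 0 (l.castLE hmm) g := by
        rw [← h.entry_zero_zero (N := 2 * m), entry_mul, entry_mul, entry_mul, hgβ, mul_assoc, hβg]
      rw [Fin.castLEEmb_apply, hbl, star_mul, hβ.star_eq, map_mul, map_mul, map_mul, map_star,
        ht, ht, star_mul, star_mul, star_entry, star_entry, hg.star_eq]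
      simp only [mul_assoc]
    have : h.corner (∑ l, t k l * β * star (t k' l * β) - if k = k' then w else 0) =
        -(h.entry 0 k g * (∑ i : Fin (2 * m), h.entry i i w - r * (∑ l ∈ s₀, h.entry l l (β * β)) * star r) *
          h.entry k' 0 g) := by
      rw [map_sub, ← hb', ← hw', mul_sub, sub_mul, neg_sub]
    rw [← NonUnitalStarAlgHom.norm_map h.corner h.corner_injective, this, norm_neg]
    calc _ ≤ ‖h.entry 0 k g‖ * ‖_‖ * ‖h.entry k' 0 g‖ := norm_mul₃_le
      _ ≤ 1 * ε * 1 := by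
          gcongr
          · exact (h.norm_entry_zero_le k hg hg1).1
          · exact (h.norm_entry_zero_le k' hg hg1).2
      _ = ε := by ring

/-- Weak divisibility of `m•[β²]`, realised approximately by elements of `A` having `p` as a
unit. -/
theorem exists_near_of_isWeaklyDivisible {m n : ℕ} (hm : 1 ≤ m) {β g g' p : A}
    (hβ : IsSelfAdjoint β) (hg : IsSelfAdjoint g) (hg' : IsSelfAdjoint g') (hp : IsSelfAdjoint p)
    (hβ1 : ‖β‖ ≤ 1) (hg1 : ‖g‖ ≤ 1) (hg'1 : ‖g'‖ ≤ 1) (hgβ : g * β = β) (hg'g : g' * g = g)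
    (hpg' : p * g' = g') (hdiv : CuDiv.IsWeaklyDivisible (2 * m) n (m • h.clsA (β * β)))
    {ε : ℝ} (hε : 0 < ε) (hε1 : ε ≤ 1) :
    ∃ (w : Fin n → A) (s : Fin n → Fin (2 * m) → Fin m → A),
      (∀ j, p * w j = w j ∧ w j * p = w j) ∧
      (∀ j k l, p * s j k l = s j k l ∧ s j k l * p = s j k l) ∧
      (∀ j, ‖w j‖ ≤ 2) ∧ (∀ j k l, ‖s j k l‖ ≤ 2) ∧ ‖β * β - ∑ j, w j‖ ≤ ε ∧
      ∀ j k k', ‖∑ l, s j k l * star (s j k' l) - if k = k' then w j else 0‖ ≤ ε := by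
  have hb : CStarNonneg (β * β) := ⟨β, by rw [hβ.star_eq]⟩
  have hβg : β * g = β := by simpa [hβ.star_eq, hg.star_eq] using congrArg star hgβ
  have hb1 : ‖β * β‖ ≤ 1 := (norm_mul_le _ _).trans (mul_le_one₀ hβ1 (norm_nonneg _) hβ1)
  set c := h.corner (β * β) with hc
  have hcn : CStarNonneg c := hb.map h.corner
  set a := cfcₙ (fun t : ℝ => max (t - ε / 2) 0) c with ha
  have hac : ‖c - a‖ ≤ ε / 2 := hcn.norm_sub_cutdown_le (half_pos hε)
  have hway : WayBelow (h.cls a) (h.cls c) :=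
    (h.waybelow_iff _ _ hcn).2 ⟨ε / 2, half_pos hε, le_rfl⟩
  obtain ⟨y, hy, hym⟩ := hdiv _ (CuSemigroup.wayBelow_nsmul hway m)
  obtain ⟨v, hv, hvy, hvn⟩ := h.exists_sum_near n y (CStarNonneg.cutdown (ε / 2))
    ((CuSemigroup.le_nsmul_self _ hm).trans hy) (half_pos hε)
  choose w hw using fun j => by
    simpa only [entry_zero_zero] using h.entry_mul_mul_entry_mem (N := 1) 0 0 g g (v j)
  have hwv : ∀ j, h.corner (w j) = h.corner g * v j * star (h.corner g) := fun j => by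
    rw [hw, ← map_star, hg.star_eq]
  have hwn : ∀ j, CStarNonneg (h.corner (w j)) := fun j => by
    rw [hwv]
    exact (hv j).conj _
  have hwnn : ∀ j, CStarNonneg (w j) := fun j => (hwn j).of_map h.corner h.corner_injective
  have hunit : ∀ q : A, q * g = g → ∀ j, q * w j = w j := fun q hq j => by
    apply h.corner_injective
    rw [map_mul, hw, ← mul_assoc, ← mul_assoc, ← map_mul, hq]
  have hpg : p * g = g := by rw [← hg'g, ← mul_assoc, hpg']
  have hcg : ‖h.corner g‖ ≤ 1 := by
    rwa [NonUnitalStarAlgHom.norm_map h.corner h.corner_injective]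
  have hconj : ∀ z, ‖h.corner g * z * h.corner g‖ ≤ ‖z‖ := fun z =>
    calc _ ≤ ‖h.corner g‖ * ‖z‖ * ‖h.corner g‖ := norm_mul₃_le
      _ ≤ 1 * ‖z‖ * 1 := by gcongr
      _ = ‖z‖ := by ring
  have hsum : ‖β * β - ∑ j, w j‖ ≤ ε := by
    have : h.corner (β * β - ∑ j, w j) =
        h.corner g * ((c - a) + (a - ∑ j, v j)) * h.corner g := by
      rw [sub_add_sub_cancel, mul_sub, sub_mul, hc, ← map_mul, ← map_mul, map_sub, map_sum,
        Finset.mul_sum, Finset.sum_mul]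
      simp only [hw]
      rw [← mul_assoc, hgβ, mul_assoc, hβg]
    rw [← NonUnitalStarAlgHom.norm_map h.corner h.corner_injective, this]
    calc _ ≤ _ := hconj _
      _ ≤ ‖c - a‖ + ‖a - ∑ j, v j‖ := norm_add_le _ _
      _ ≤ ε / 2 + ε / 2 := add_le_add hac hvn.le
      _ = ε := add_halves ε
  have hw2 : ∀ j, ‖w j‖ ≤ 2 := fun j =>
    calc ‖w j‖ ≤ ‖∑ j, w j‖ :=
          CStarNonneg.norm_le_norm_sum (fun i _ => hwnn i) (Finset.mem_univ j)
      _ = ‖β * β - (β * β - ∑ j, w j)‖ := by rw [sub_sub_cancel]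
      _ ≤ ‖β * β‖ + ‖β * β - ∑ j, w j‖ := norm_sub_le _ _
      _ ≤ 2 := by linarith
  have hle : ∀ j, (2 * m) • h.cls (h.corner (w j)) ≤ m • h.cls (h.corner (β * β)) := fun j => by
    refine (CuSemigroup.nsmul_le_nsmul_of_le ?_ _).trans (hym j)
    rw [hwv]
    exact (h.cls_conj_le (hv j) _).trans (hvy j)
  choose s hsp hs using fun j => h.exists_matrix_near hm hβ hg' hp hg'1
    (by rw [← hgβ, ← mul_assoc, hg'g]) hpg' (hwnn j) (hunit g' hg'g j) (hle j) hε
  refine ⟨w, s, fun j => ⟨hunit p hpg j, ?_⟩, hsp, hw2, fun j k l => ?_, hsum, hs⟩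
  · simpa [(hwnn j).isSelfAdjoint.star_eq, hp.star_eq] using congrArg star (hunit p hpg j)
  · have h₁ : ‖s j k l * star (s j k l)‖ ≤ ‖∑ l, s j k l * star (s j k l)‖ :=
      CStarNonneg.norm_le_norm_sum (a := fun l => s j k l * star (s j k l))
        (fun l _ => cstarNonneg_mul_star_self _) (Finset.mem_univ l)
    have h₂ := hs j k k
    rw [if_pos rfl] at h₂
    have h₃ : ‖∑ l, s j k l * star (s j k l)‖ ≤ ε + 2 := by
      rw [← sub_add_cancel (∑ l, s j k l * star (s j k l)) (w j)]
      exact (norm_add_le _ _).trans (add_le_add h₂ (hw2 j))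
    rw [CStarRing.norm_self_mul_star] at h₁
    nlinarith [norm_nonneg (s j k l)]

end IsCuntzSemigroupOf

section Scalars

theorem exists_relation_of_lt {m N : ℕ} (h : m < N) (σ : Fin N → Fin m → ℂ) :
    ∃ c : Fin N → ℂ, c ≠ 0 ∧ ∀ l, ∑ k, c k * σ k l = 0 := by
  have hker := LinearMap.ker_ne_bot_of_finrank_lt (f := Matrix.vecMulLinear (Matrix.of σ))
    (by simpa using h)
  obtain ⟨c, hc, hc0⟩ := (Submodule.ne_bot_iff _).1 hker
  refine ⟨c, hc0, fun l => ?_⟩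
  simpa [Matrix.vecMul, dotProduct] using congrFun (LinearMap.mem_ker.1 hc) l

/-- A multiple of the identity of size `2m` that is `ε`-close, entrywise, to a Gram matrix of rank
at most `m` is small. -/
theorem norm_le_of_gram_near {m : ℕ} (hm : 1 ≤ m) (σ : Fin (2 * m) → Fin m → ℂ) (ω : ℂ) {ε : ℝ}
    (h : ∀ k k', ‖∑ l, σ k l * star (σ k' l) - if k = k' then ω else 0‖ ≤ ε) :
    ‖ω‖ ≤ 2 * m * ε := by
  obtain ⟨c, hc0, hc⟩ := exists_relation_of_lt (by omega : m < 2 * m) σ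
  have hε : 0 ≤ ε := (norm_nonneg _).trans (h ⟨0, by omega⟩ ⟨0, by omega⟩)
  set X : ℝ := ∑ k, ‖c k‖ ^ 2 with hX
  have hXpos : 0 < X := by
    obtain ⟨k, hk⟩ := Function.ne_iff.1 hc0
    exact Finset.sum_pos' (fun _ _ => by positivity)
      ⟨k, Finset.mem_univ k, by have := norm_pos_iff.2 hk; positivity⟩
  have key : ∑ k, ∑ k', c k * star (c k') *
      (∑ l, σ k l * star (σ k' l) - if k = k' then ω else 0) = -(ω * X) := by
    have h₁ : ∑ k, ∑ k', c k * star (c k') * ∑ l, σ k l * star (σ k' l) = 0 := by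
      calc _ = ∑ k', ∑ l, (∑ k, c k * σ k l) * (star (c k') * star (σ k' l)) := by
            rw [Finset.sum_comm]
            refine Finset.sum_congr rfl fun k' _ => ?_
            simp only [Finset.mul_sum, Finset.sum_mul]
            rw [Finset.sum_comm]
            refine Finset.sum_congr rfl fun k _ => Finset.sum_congr rfl fun l _ => ?_
            ring
        _ = 0 := by simp [hc]
    have h₂ : ∑ k, ∑ k', c k * star (c k') * (if k = k' then ω else 0) = ω * X := by
      simp only [mul_ite, mul_zero, Finset.sum_ite_eq, Finset.mem_univ, if_true, hX]
      push_cast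
      rw [Finset.mul_sum]
      refine Finset.sum_congr rfl fun k _ => ?_
      rw [mul_comm, ← Complex.mul_conj']
      rfl
    simp only [mul_sub, Finset.sum_sub_distrib, h₁, h₂, zero_sub]
  have hbound : ‖ω‖ * X ≤ ε * (2 * m * X) := by
    calc ‖ω‖ * X = ‖-(ω * X)‖ := by
          rw [norm_neg, norm_mul, Complex.norm_real, Real.norm_of_nonneg hXpos.le]
      _ ≤ ∑ k, ∑ k', ‖c k‖ * ‖c k'‖ * ε := by
          rw [← key]
          refine (norm_sum_le _ _).trans (Finset.sum_le_sum fun k _ =>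
            (norm_sum_le _ _).trans (Finset.sum_le_sum fun k' _ => ?_))
          rw [norm_mul, norm_mul, norm_star]
          exact mul_le_mul_of_nonneg_left (h k k') (by positivity)
      _ = ε * (∑ k, ‖c k‖) ^ 2 := by
          rw [sq, Finset.sum_mul_sum, Finset.mul_sum]
          refine Finset.sum_congr rfl fun k _ => ?_
          rw [Finset.mul_sum]
          exact Finset.sum_congr rfl fun k' _ => mul_comm _ _
      _ ≤ ε * (2 * m * X) := by
          refine mul_le_mul_of_nonneg_left ?_ hε
          simpa using sq_sum_le_card_mul_sum_sq (s := Finset.univ) (f := fun k => ‖c k‖)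
  nlinarith

end Scalars

section Ramp

/-- The piecewise linear function that vanishes for `s * t ≤ c` and is `1` for `c + 1 ≤ s * t`. -/
noncomputable def ramp (s c t : ℝ) : ℝ := min 1 (max 0 (s * t - c))

@[fun_prop]
theorem continuous_ramp (s c : ℝ) : Continuous (ramp s c) := by
  unfold ramp
  fun_prop

theorem ramp_nonneg (s c t : ℝ) : 0 ≤ ramp s c t := le_min zero_le_one (le_max_left _ _)

theorem ramp_le_one (s c t : ℝ) : ramp s c t ≤ 1 := min_le_left _ _

theorem ramp_eq_zero {s c t : ℝ} (h : s * t ≤ c) : ramp s c t = 0 := by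
  rw [ramp, max_eq_left (by linarith), min_eq_right zero_le_one]

theorem ramp_eq_one {s c t : ℝ} (h : c + 1 ≤ s * t) : ramp s c t = 1 :=
  min_eq_left (le_max_of_le_right (by linarith))

theorem ramp_zero {s c : ℝ} (hc : 0 ≤ c) : ramp s c 0 = 0 := ramp_eq_zero (by simpa using hc)

theorem exists_ramp_eq_mul {s c : ℝ} (hs : 0 < s) (hc : 0 < c) :
    ∃ κ : ℝ → ℝ, Continuous κ ∧ ∀ t, ramp s c t = t * κ t := by
  have hpos : ∀ t, 0 < max t (c / s) := fun t => lt_max_of_lt_right (by positivity)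
  refine ⟨fun t => ramp s c t / max t (c / s), ?_, fun t => ?_⟩
  · exact (continuous_ramp s c).div (by fun_prop) fun t => (hpos t).ne'
  · rcases le_total t (c / s) with h | h
    · have h0 : ramp s c t = 0 := ramp_eq_zero (by rw [mul_comm]; exact (le_div_iff₀ hs).1 h)
      simp [h0]
    · have ht : t ≠ 0 := fun h0 => by
        have : 0 < c / s := by positivity
        linarith
      simp only [max_eq_left h, mul_div_cancel₀ _ ht]

theorem ramp_mul_ramp {s c s' c' : ℝ} (hs : 0 < s) (hs' : 0 < s') (h : (c + 1) * s' ≤ c' * s)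
    (t : ℝ) : ramp s c t * ramp s' c' t = ramp s' c' t := by
  rcases le_total (s' * t) c' with h' | h'
  · rw [ramp_eq_zero h', mul_zero]
  · rw [ramp_eq_one (s := s) (c := c), one_mul]
    have : (c + 1) * s' ≤ (s * t) * s' := by nlinarith
    exact le_of_mul_le_mul_right this hs'

variable {B : Type*} [NonUnitalCStarAlgebra B]

theorem norm_cfcₙ_ramp_le (s c : ℝ) (a : B) : ‖cfcₙ (ramp s c) a‖ ≤ 1 :=
  norm_cfcₙ_le fun t _ => by
    rw [Real.norm_of_nonneg (ramp_nonneg s c t)]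
    exact ramp_le_one s c t

theorem cfcₙ_ramp_mul_ramp {s c s' c' : ℝ} (hs : 0 < s) (hs' : 0 < s') (hc : 0 ≤ c)
    (hc' : 0 ≤ c') (h : (c + 1) * s' ≤ c' * s) (a : B) :
    cfcₙ (ramp s c) a * cfcₙ (ramp s' c') a = cfcₙ (ramp s' c') a := by
  rw [← cfcₙ_mul (ramp s c) (ramp s' c') a (by fun_prop) (ramp_zero hc) (by fun_prop)
    (ramp_zero hc')]
  exact cfcₙ_congr fun t _ => ramp_mul_ramp hs hs' h t

end Ramp

section Ideals

noncomputable instance ClosedTwoSidedIdealC.instNonUnitalCStarAlgebra {M : Type*} [NonUnitalCStarAlgebra M]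
    (J : ClosedTwoSidedIdealC M) : NonUnitalCStarAlgebra J.carrier :=
  haveI := J.isClosed
  inferInstance

variable {M : Type*} [CStarAlgebra M] {J : ClosedTwoSidedIdealC M}
  {H : Type*} [NormedAddCommGroup H] [InnerProductSpace ℂ H] [CompleteSpace H]
  (ψ : J.carrier →⋆ₙₐ[ℂ] (H →L[ℂ] H))

theorem ideal_coe_cfcₙ {ρ : ℝ → ℝ} (hρ : Continuous ρ) (h0 : ρ 0 = 0) {x : J.carrier}
    (hx : IsSelfAdjoint x) : ((cfcₙ ρ x : J.carrier) : M) = cfcₙ ρ (x : M) :=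
  NonUnitalStarAlgHom.map_cfcₙ (S := ℂ) (NonUnitalStarSubalgebraClass.subtype J.carrier) ρ x
    (by fun_prop) h0 continuous_subtype_val hx (hx.map _)

theorem ideal_map_cfcₙ_eq {ρ : ℝ → ℝ} (hρ : Continuous ρ) (h0 : ρ 0 = 0) (h1 : ρ 1 = 1)
    {x : J.carrier} (hx : IsSelfAdjoint x) (hq : IsIdempotentElem (ψ x)) :
    ψ (cfcₙ ρ x) = ψ x := by
  have hs : IsSelfAdjoint (ψ x) := hx.map ψ
  rw [NonUnitalStarAlgHom.map_cfcₙ (S := ℂ) ψ ρ x (by fun_prop) h0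
    (continuous_of_nonUnitalStarAlgHom ψ) hx hs]
  conv_rhs => rw [← cfcₙ_id' ℝ (ψ x)]
  refine cfcₙ_congr fun t ht => ?_
  rcases hq.quasispectrum_subset ℝ ht with rfl | rfl
  · exact h0
  · exact h1

theorem norm_inner_map_le (v : H) (hv : ‖v‖ = 1) (x : J.carrier) :
    ‖inner ℂ v (ψ x v)‖ ≤ ‖(x : M)‖ := by
  calc _ ≤ ‖v‖ * ‖ψ x v‖ := norm_inner_le_norm _ _
    _ ≤ ‖v‖ * (‖ψ x‖ * ‖v‖) := by gcongr; exact (ψ x).le_opNorm v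
    _ = ‖ψ x‖ := by rw [hv]; ring
    _ ≤ ‖x‖ := NonUnitalStarAlgHom.norm_apply_le ψ x

theorem inner_map_mul {v : H} {p x : J.carrier} (hp : ψ p = InnerProductSpace.rankOne ℂ v v)
    (hx : x * p = x) (y : J.carrier) :
    inner ℂ v (ψ (x * y) v) = inner ℂ v (ψ x v) * inner ℂ v (ψ y v) := by
  have hψ : ψ x * InnerProductSpace.rankOne ℂ v v = ψ x := by rw [← hp, ← map_mul, hx]
  have : ψ (x * y) v = inner ℂ v (ψ y v) • ψ x v := by
    rw [map_mul]
    nth_rw 1 [← hψ]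
    simp
  rw [this, inner_smul_right, mul_comm]

theorem inner_map_star (v : H) (x : J.carrier) :
    inner ℂ v (ψ (star x) v) = star (inner ℂ v (ψ x v)) := by
  rw [map_star, ContinuousLinearMap.star_eq_adjoint, ContinuousLinearMap.adjoint_inner_right]
  exact (inner_conj_symm _ _).symm

end Ideals

section RankOneObstruction

variable {A : Type*} [NonUnitalCStarAlgebra A] {S : Type*} [CuSemigroup S]
  (hS : IsCuntzSemigroupOf A S) {J : ClosedTwoSidedIdealC 𝓜(ℂ, A)}
  {H : Type*} [NormedAddCommGroup H] [InnerProductSpace ℂ H] [CompleteSpace H]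
  (ψ : J.carrier →⋆ₙₐ[ℂ] (H →L[ℂ] H))

/-- Under uniform divisibility, no strict sum of orthogonal positive elements is mapped to a
rank-one projection. -/
theorem map_strictSum_ne_rankOne_of_norm_eq_one
    (hdiv : ∀ a : ℕ → A, (∀ i, CStarNonneg (a i)) → (∀ i j, i ≠ j → a i * a j = 0) →
      ∃ m n : ℕ, 1 ≤ m ∧ 1 ≤ n ∧
        ∀ i, CuDiv.IsWeaklyDivisible (2 * m) n (m • hS.clsA (a i)))
    {a : ℕ → A} (ha : StrictlyOrthogonal a) (d : J.carrier) (hd : IsStrictSum a (d : 𝓜(ℂ, A)))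
    {v : H} (hv : ‖v‖ = 1) : ψ d ≠ InnerProductSpace.rankOne ℂ v v := by
  intro hψ
  have hds : IsSelfAdjoint d := Subtype.ext (hd.isSelfAdjoint ha.selfAdjoint)
  have hidem : IsIdempotentElem (ψ d) :=
    hψ ▸ InnerProductSpace.isIdempotentElem_rankOne_self hv
  -- the elements obtained from the functions `ramp 8 c`
  have hsupp : ∀ c : ℝ, 0 < c → ∀ i, SupportedBy (a i) (cfcₙ (ramp 8 c) (a i)) := fun c hc i => by
    obtain ⟨κ, hκ, hρ⟩ := exists_ramp_eq_mul (s := 8) (by norm_num) hc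
    exact supportedBy_cfcₙ hκ hρ (ha.selfAdjoint i)
  have hsum : ∀ c : ℝ, 0 < c → IsStrictSum (fun i => cfcₙ (ramp 8 c) (a i))
      ((cfcₙ (ramp 8 c) d : J.carrier) : 𝓜(ℂ, A)) := fun c hc => by
    obtain ⟨κ, hκ, hρ⟩ := exists_ramp_eq_mul (s := 8) (by norm_num) hc
    rw [ideal_coe_cfcₙ (continuous_ramp 8 c) (ramp_zero hc.le) hds]
    exact hd.cfcₙ ha hκ hρ
  have hmap : ∀ c : ℝ, 0 < c → c + 1 ≤ 8 → ψ (cfcₙ (ramp 8 c) d) =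
      InnerProductSpace.rankOne ℂ v v := fun c hc hc' => by
    rw [ideal_map_cfcₙ_eq ψ (continuous_ramp 8 c) (ramp_zero hc.le)
      (ramp_eq_one (by linarith)) hds hidem, hψ]
  have hself : ∀ c i, IsSelfAdjoint (cfcₙ (ramp 8 c) (a i)) := fun c i => cfcₙ_predicate _ _
  have hmul : ∀ c c' : ℝ, 0 ≤ c → c + 1 ≤ c' → ∀ i,
      cfcₙ (ramp 8 c) (a i) * cfcₙ (ramp 8 c') (a i) = cfcₙ (ramp 8 c') (a i) :=
    fun c c' hc hcc i => cfcₙ_ramp_mul_ramp (by norm_num) (by norm_num) hc (by linarith)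
      (by linarith) _
  set β : ℕ → A := fun i => cfcₙ (ramp 8 4) (a i) with hβ
  set p : ℕ → A := fun i => cfcₙ (ramp 8 1) (a i) with hp
  set P : J.carrier := cfcₙ (ramp 8 1) d with hP
  set b : J.carrier := cfcₙ (ramp 8 4) d with hb
  have hPsum : IsStrictSum p (P : 𝓜(ℂ, A)) := hsum 1 one_pos
  have hβsum : IsStrictSum β (b : 𝓜(ℂ, A)) := hsum 4 (by norm_num)
  have hPψ : ψ P = InnerProductSpace.rankOne ℂ v v := hmap 1 one_pos (by norm_num)
  have hbψ : ψ b = InnerProductSpace.rankOne ℂ v v := hmap 4 (by norm_num) (by norm_num)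
  have hpa : ∀ i, SupportedBy (a i) (p i) := hsupp 1 one_pos
  have hβa : ∀ i, SupportedBy (a i) (β i) := hsupp 4 (by norm_num)
  obtain ⟨m, n, hm, hn, hdiv⟩ := hdiv (fun i => β i * β i)
    (fun i => ⟨β i, by rw [(hself 4 i).star_eq]⟩)
    (fun i j hij => ((hβa i).mul (hβa i)).mul_eq_zero ((hβa j).mul (hβa j)) (ha.orth i j hij))
  have hm' : (1 : ℝ) ≤ m := by exact_mod_cast hm
  have hn' : (1 : ℝ) ≤ n := by exact_mod_cast hn
  set ε : ℝ := 1 / (4 * (m * n)) with hε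
  have hmn : (1 : ℝ) ≤ m * n := one_le_mul_of_one_le_of_one_le hm' hn'
  have hε0 : 0 < ε := by positivity
  have hε4 : ε ≤ 1 / 4 := one_div_le_one_div_of_le (by norm_num) (by linarith)
  choose w s hw hs hw2 hs2 hwβ hsw using fun i => hS.exists_near_of_isWeaklyDivisible hm
    (hself 4 i) (hself 3 i) (hself 2 i) (hself 1 i) (norm_cfcₙ_ramp_le _ _ _)
    (norm_cfcₙ_ramp_le _ _ _) (norm_cfcₙ_ramp_le _ _ _)
    (hmul 3 4 (by norm_num) (by norm_num) i) (hmul 2 3 (by norm_num) (by norm_num) i)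
    (hmul 1 2 (by norm_num) (by norm_num) i) (hdiv i) hε0 (by linarith)
  have hwa : ∀ i j, SupportedBy (a i) (w i j) := fun i j =>
    (hpa i).trans (SupportedBy.of_unit (hw i j).1 (hw i j).2)
  have hsa : ∀ i j k l, SupportedBy (a i) (s i j k l) := fun i j k l =>
    (hpa i).trans (SupportedBy.of_unit (hs i j k l).1 (hs i j k l).2)
  -- strict sums of families having `p` as a unit lie in the ideal
  have hex : ∀ t : ℕ → A, (∀ i, ‖t i‖ ≤ 2) → (∀ i, t i * p i = t i) →
      (∀ i, SupportedBy (a i) (t i)) →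
      ∃ T : J.carrier, T * P = T ∧ IsStrictSum t (T : 𝓜(ℂ, A)) := by
    intro t ht2 htp hta
    obtain ⟨T, hT⟩ := ha.exists_isStrictSum zero_le_two ht2 hta
    have hTP : T * P = T := by
      refine IsStrictSum.unique (t := t) ?_ hT
      have := hT.mul hPsum fun i j hij => (hta i).mul_eq_zero (hpa j) (ha.orth i j hij)
      simpa only [htp] using this
    have hTJ : T ∈ J.carrier := hTP ▸ J.mul_mem_left T P P.2
    exact ⟨⟨T, hTJ⟩, Subtype.ext hTP, hT⟩
  choose W hWP hW using fun j => hex (fun i => w i j) (fun i => hw2 i j) (fun i => (hw i j).2)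
    (fun i => hwa i j)
  choose T hTP hT using fun j k l => hex (fun i => s i j k l) (fun i => hs2 i j k l)
    (fun i => (hs i j k l).2) (fun i => hsa i j k l)
  have hnorm₁ : ‖((b * b - ∑ j, W j : J.carrier) : 𝓜(ℂ, A))‖ ≤ ε := by
    have h₁ := (hβsum.mul hβsum fun i j hij =>
      (hβa i).mul_eq_zero (hβa j) (ha.orth i j hij)).sub
      (IsStrictSum.sum Finset.univ fun j _ => hW j)
    have h₂ := h₁.norm_le ha hε0.le hwβ fun i =>
      ((hβa i).mul (hβa i)).sub (SupportedBy.sum _ fun j _ => hwa i j)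
    convert h₂ using 2
    push_cast
    rfl
  have hnorm₂ : ∀ j k k', ‖((∑ l, T j k l * star (T j k' l) - if k = k' then W j else 0 :
      J.carrier) : 𝓜(ℂ, A))‖ ≤ ε := by
    intro j k k'
    have hite : IsStrictSum (fun i => if k = k' then w i j else 0)
        ((if k = k' then W j else 0 : J.carrier) : 𝓜(ℂ, A)) := by
      split_ifs
      · exact hW j
      · exact IsStrictSum.zero
    have h₁ := (IsStrictSum.sum Finset.univ fun l _ => (hT j k l).mul (hT j k' l).star
      fun i i' hi => (hsa i j k l).mul_eq_zero ((hsa i' j k' l).star (ha.selfAdjoint i'))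
        (ha.orth i i' hi)).sub hite
    have h₂ := h₁.norm_le ha hε0.le (fun i => hsw i j k k') fun i =>
      (SupportedBy.sum _ fun l _ => (hsa i j k l).mul
        ((hsa i j k' l).star (ha.selfAdjoint i))).sub (by
          split_ifs
          · exact hwa i j
          · exact SupportedBy.zero _)
    convert h₂ using 2
    push_cast
    rfl
  -- evaluation at the vector state of `v`
  set χ : J.carrier → ℂ := fun x => inner ℂ v (ψ x v) with hχ
  have hχ0 : χ 0 = 0 := by simp [hχ]
  have hχsub : ∀ x y, χ (x - y) = χ x - χ y := fun x y => by simp [hχ]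
  have hχsum : ∀ {ι : Type} (F : Finset ι) (x : ι → J.carrier), χ (∑ i ∈ F, x i) = ∑ i ∈ F, χ (x i) :=
    fun F x => by simp [hχ]
  have hχb : χ (b * b) = 1 := by
    simp [hχ, hbψ, hv]
  have hω : ∀ j, ‖χ (W j)‖ ≤ 2 * m * ε := fun j => by
    refine norm_le_of_gram_near hm (fun k l => χ (T j k l)) (χ (W j)) fun k k' => ?_
    refine le_trans (le_of_eq ?_) ((norm_inner_map_le ψ v hv _).trans (hnorm₂ j k k'))
    congr 1
    change _ = χ _
    rw [hχsub, hχsum]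
    congr 1
    · refine Finset.sum_congr rfl fun l _ => ?_
      rw [← inner_map_star ψ v]
      exact (inner_map_mul ψ hPψ (hTP j k l) _).symm
    · split_ifs
      · rfl
      · exact hχ0.symm
  have h1 : ‖1 - ∑ j, χ (W j)‖ ≤ ε := by
    have := (norm_inner_map_le ψ v hv _).trans hnorm₁
    change ‖χ _‖ ≤ ε at this
    rwa [hχsub, hχsum, hχb] at this
  have h2 : ‖∑ j, χ (W j)‖ ≤ 1 / 2 := by
    calc _ ≤ ∑ j : Fin n, 2 * m * ε := (norm_sum_le _ _).trans (Finset.sum_le_sum fun j _ => hω j)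
      _ = 1 / 2 := by
          rw [Finset.sum_const, Finset.card_univ, Fintype.card_fin, nsmul_eq_mul, hε]
          field_simp
          norm_num
  have h3 : (1 : ℝ) ≤ ‖1 - ∑ j, χ (W j)‖ + ‖∑ j, χ (W j)‖ := by
    calc (1 : ℝ) = ‖(1 - ∑ j, χ (W j)) + ∑ j, χ (W j)‖ := by simp
      _ ≤ _ := norm_add_le _ _
  linarith

end RankOneObstruction

section Scaling

variable {A : Type*} [NonUnitalCStarAlgebra A]

theorem StrictlyOrthogonal.of_supportedBy {a b : ℕ → A} (ha : StrictlyOrthogonal a)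
    (hb : ∀ i, IsSelfAdjoint (b i)) (h : ∀ i, SupportedBy (a i) (b i)) : StrictlyOrthogonal b where
  selfAdjoint := hb
  orth i j hij := (h i).mul_eq_zero (h j) (ha.orth i j hij)
  tail x ε hε := by
    obtain ⟨y, hy, N, hN⟩ := ha.tail x ε hε
    exact ⟨y, hy, N, fun i hi => (h i).1 _ (hN i hi)⟩

theorem SupportedBy.smul {a t : A} (c : ℂ) (h : SupportedBy a t) : SupportedBy a (c • t) :=
  ⟨fun x hx => by rw [smul_mul_assoc, h.1 x hx, smul_zero],
    fun x hx => by rw [mul_smul_comm, h.2 x hx, smul_zero]⟩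

theorem strictlyOrthogonal_single {a : A} (ha : IsSelfAdjoint a) :
    StrictlyOrthogonal (fun i : ℕ => if i = 0 then a else 0) where
  selfAdjoint i := by
    split_ifs
    exacts [ha, .zero A]
  orth i j hij := by
    split_ifs <;> simp_all
  tail x ε hε := ⟨x, by simpa using hε, 1, fun i hi => by simp [Nat.one_le_iff_ne_zero.1 hi]⟩

theorem isStrictSum_single (a : A) :
    IsStrictSum (fun i : ℕ => if i = 0 then a else 0) (a : 𝓜(ℂ, A)) where
  left x := by
    refine tendsto_const_nhds.congr' ?_
    filter_upwards [eventually_gt_atTop 0] with N hN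
    rw [Finset.sum_eq_single_of_mem 0 (Finset.mem_range.2 hN) fun i _ hi => by simp [hi]]
    simp
  right x := by
    refine tendsto_const_nhds.congr' ?_
    filter_upwards [eventually_gt_atTop 0] with N hN
    rw [Finset.sum_eq_single_of_mem 0 (Finset.mem_range.2 hN) fun i _ hi => by simp [hi]]
    simp

variable {S : Type*} [CuSemigroup S]
  (hS : IsCuntzSemigroupOf A S) {J : ClosedTwoSidedIdealC 𝓜(ℂ, A)}
  {H : Type*} [NormedAddCommGroup H] [InnerProductSpace ℂ H] [CompleteSpace H]
  (ψ : J.carrier →⋆ₙₐ[ℂ] (H →L[ℂ] H))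

set_option synthInstance.maxHeartbeats 200000 in
/-- Under uniform divisibility, no strict sum of orthogonal elements is of the form `y * star y`
modulo the kernel of `ψ`, where `ψ y` has rank one. -/
theorem map_strictSum_ne_rankOne_mul_star
    (hdiv : ∀ a : ℕ → A, (∀ i, CStarNonneg (a i)) → (∀ i j, i ≠ j → a i * a j = 0) →
      ∃ m n : ℕ, 1 ≤ m ∧ 1 ≤ n ∧
        ∀ i, CuDiv.IsWeaklyDivisible (2 * m) n (m • hS.clsA (a i)))
    {a : ℕ → A} (ha : StrictlyOrthogonal a) (d : J.carrier) (hd : IsStrictSum a (d : 𝓜(ℂ, A)))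
    {w u : H} (hw : w ≠ 0) (hu : u ≠ 0) :
    ψ d ≠ InnerProductSpace.rankOne ℂ w u * star (InnerProductSpace.rankOne ℂ w u) := by
  intro hψ
  have hw' : 0 < ‖w‖ := norm_pos_iff.2 hw
  have hu' : 0 < ‖u‖ := norm_pos_iff.2 hu
  set c : ℝ := (‖u‖ * ‖w‖)⁻¹ ^ 2 with hc
  have hself : ∀ i, IsSelfAdjoint ((c : ℂ) • a i) := fun i =>
    IsSelfAdjoint.smul (by simp [isSelfAdjoint_iff]) (ha.selfAdjoint i)
  refine map_strictSum_ne_rankOne_of_norm_eq_one hS ψ hdiv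
    (ha.of_supportedBy hself fun i => (SupportedBy.refl _).smul _) ((c : ℂ) • d)
    (hd.smul (c : ℂ)) (v := ((‖w‖⁻¹ : ℝ) : ℂ) • w) ?_ ?_
  · rw [norm_smul, Complex.norm_real, norm_inv, norm_norm, inv_mul_cancel₀ hw'.ne']
  · rw [map_smul, hψ]
    ext z
    simp only [hc, ContinuousLinearMap.star_eq_adjoint, InnerProductSpace.adjoint_rankOne,
      smul_apply, ContinuousLinearMap.mul_def, ContinuousLinearMap.comp_apply,
      InnerProductSpace.rankOne_apply, inner_smul_right, inner_smul_left,
      inner_self_eq_norm_sq_to_K, smul_smul]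
    congr 1
    have h1 : (‖u‖ : ℂ) ≠ 0 := by exact_mod_cast hu'.ne'
    have h2 : (‖w‖ : ℂ) ≠ 0 := by exact_mod_cast hw'.ne'
    simp only [Complex.ofReal_pow, Complex.ofReal_inv, Complex.ofReal_mul, map_inv₀,
      Complex.conj_ofReal, Complex.coe_algebraMap]
    field_simp

end Scaling

section CompactRange

variable {M : Type*} [CStarAlgebra M] {J : ClosedTwoSidedIdealC M}
  {H : Type*} [NormedAddCommGroup H] [InnerProductSpace ℂ H] [CompleteSpace H]
  {ψ : J.carrier →⋆ₙₐ[ℂ] (H →L[ℂ] H)}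

theorem exists_map_eq_rankOne
    (hrange : Set.range ψ = {T : H →L[ℂ] H | IsCompactOperator ⇑T}) (u v : H) :
    ∃ x, ψ x = InnerProductSpace.rankOne ℂ u v :=
  hrange.superset <| (isCompactOperator_of_locallyCompactSpace_dom (innerSL ℂ v)).clm_comp
    (ContinuousLinearMap.toSpanSingleton ℂ u)

end CompactRange

section ApproximateUnit

variable {A : Type*} [NonUnitalCStarAlgebra A]

/-- An approximate unit each of whose elements is a unit for the preceding ones. -/
structure IsNestedApproxUnit (e : ℕ → A) : Prop where
  selfAdjoint : ∀ k, IsSelfAdjoint (e k)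
  norm_le_one : ∀ k, ‖e k‖ ≤ 1
  mul_eq : ∀ k j, k < j → e j * e k = e k
  tendsto : ∀ x, Tendsto (fun k => e k * x) atTop (𝓝 x)

theorem norm_multiplierCoe (x : A) : ‖(x : 𝓜(ℂ, A))‖ = ‖x‖ :=
  NonUnitalStarAlgHom.norm_map (DoubleCentralizer.coeHom (𝕜 := ℂ) (A := A))
    multiplierCoe_injective x

theorem CStarNonneg.norm_sub_ramp_mul_le {h : A} (hh : CStarNonneg h) (k : ℕ) :
    ‖h - cfcₙ (ramp (2 ^ (k + 1)) 1) h * h‖ ≤ (1 / 2) ^ k := by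
  let := CStarAlgebra.spectralOrder A
  let := CStarAlgebra.spectralOrderedRing A
  have hs := hh.isSelfAdjoint
  have h0 : 0 ≤ h := CStarAlgebra.nonneg_iff_eq_star_mul_self.2 hh
  have : h - cfcₙ (ramp (2 ^ (k + 1)) 1) h * h =
      cfcₙ (fun t => t - ramp (2 ^ (k + 1)) 1 t * t) h := by
    rw [cfcₙ_sub (fun t : ℝ => t) (fun t => ramp (2 ^ (k + 1)) 1 t * t) h (by fun_prop) rfl
      (by fun_prop) (by simp), cfcₙ_mul (ramp (2 ^ (k + 1)) 1) (fun t : ℝ => t) h (by fun_prop)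
      (ramp_zero zero_le_one) (by fun_prop) rfl, cfcₙ_id' ℝ h]
  rw [this]
  refine norm_cfcₙ_le fun t ht => ?_
  have ht0 : 0 ≤ t := quasispectrum_nonneg_of_nonneg h h0 t ht
  have hpow : (0 : ℝ) < 2 ^ k := by positivity
  rcases le_total t ((1 / 2) ^ k) with hk | hk
  · have h1 := ramp_nonneg (2 ^ (k + 1)) 1 t
    have h2 := ramp_le_one (2 ^ (k + 1)) 1 t
    rw [Real.norm_of_nonneg (by nlinarith)]
    nlinarith
  · rw [ramp_eq_one]
    · simp
    · rw [one_div, inv_pow, inv_le_iff_one_le_mul₀ hpow] at hk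
      rw [pow_succ]
      linarith

theorem CStarNonneg.norm_conj_le_of_tendsto {a : ℕ → A} (ha : ∀ i, CStarNonneg (a i)) {h : A}
    (hh : Tendsto (fun N => ∑ i ∈ Finset.range N, a i) atTop (𝓝 h)) (T : 𝓜(ℂ, A)) (n : ℕ) :
    ‖T * (a n : 𝓜(ℂ, A)) * star T‖ ≤ ‖T * (h : 𝓜(ℂ, A)) * star T‖ := by
  set φ := DoubleCentralizer.coeHom (𝕜 := ℂ) (A := A)
  have hc : Continuous fun x : A => ‖T * φ x * star T‖ := by
    have := continuous_of_nonUnitalStarAlgHom φ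
    fun_prop
  refine ge_of_tendsto ((hc.tendsto h).comp hh) ?_
  filter_upwards [eventually_gt_atTop n] with N hN
  rw [Function.comp_apply, map_sum, Finset.mul_sum, Finset.sum_mul]
  exact CStarNonneg.norm_le_norm_sum (a := fun i => T * φ (a i) * star T)
    (fun i _ => ((ha i).map φ).conj T) (Finset.mem_range.2 hN)

theorem CStarNonneg.of_tendsto {a : ℕ → A} (ha : ∀ i, CStarNonneg (a i)) {h : A}
    (hh : Tendsto a atTop (𝓝 h)) : CStarNonneg h := by
  let := CStarAlgebra.spectralOrder A
  let := CStarAlgebra.spectralOrderedRing A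
  exact CStarAlgebra.nonneg_iff_eq_star_mul_self.1 <|
    ge_of_tendsto hh (Eventually.of_forall fun i =>
      CStarAlgebra.nonneg_iff_eq_star_mul_self.2 (ha i))

theorem SigmaUnital.exists_isNestedApproxUnit (hA : SigmaUnital A) :
    ∃ e : ℕ → A, IsNestedApproxUnit e := by
  obtain ⟨u, hu, hlim⟩ := hA
  choose b hb using fun n => (hu n).1
  have hb1 : ∀ n, ‖b n‖ ≤ 1 := fun n => by
    have := (hu n).2
    rw [hb n, CStarRing.norm_star_mul_self] at this
    nlinarith [norm_nonneg (b n)]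
  set z : ℕ → A := fun n => ((1 / 2 : ℂ) ^ n) • star (b n) with hz
  have hzn : ∀ n, ‖z n‖ ≤ (1 / 2) ^ n := fun n => by
    rw [hz]
    dsimp only
    rw [norm_smul, norm_star, norm_pow]
    calc _ ≤ ‖(1 / 2 : ℂ)‖ ^ n * 1 := by gcongr; exact hb1 n
      _ = (1 / 2) ^ n := by norm_num
  have hsum : Summable fun n => z n * star (z n) := by
    refine Summable.of_norm_bounded summable_geometric_two fun n => ?_
    rw [CStarRing.norm_self_mul_star]
    calc ‖z n‖ * ‖z n‖ ≤ (1 / 2) ^ n * 1 := by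
          gcongr
          · exact hzn n
          · exact (hzn n).trans (pow_le_one₀ (by norm_num) (by norm_num))
      _ = _ := mul_one _
  obtain ⟨h, hh⟩ := hsum
  have hh := hh.tendsto_sum_nat
  have hpos : ∀ n, CStarNonneg (z n * star (z n)) := fun n => cstarNonneg_mul_star_self _
  have hh0 : CStarNonneg h :=
    CStarNonneg.of_tendsto (fun N => CStarNonneg.sum _ fun i _ => hpos i) hh
  set e : ℕ → A := fun k => cfcₙ (ramp (2 ^ (k + 1)) 1) h with he
  have he1 : ∀ k, ‖e k‖ ≤ 1 := fun k => norm_cfcₙ_ramp_le _ _ _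
  have hest : ∀ n k, ‖z n - e k * z n‖ ^ 2 ≤ 2 * (1 / 2) ^ k := fun n k => by
    have key := CStarNonneg.norm_conj_le_of_tendsto hpos hh (1 - (e k : 𝓜(ℂ, A))) n
    have hconj : ∀ x : A, (1 - (e k : 𝓜(ℂ, A))) * (x : 𝓜(ℂ, A)) =
        ((x - e k * x : A) : 𝓜(ℂ, A)) := fun x => by
      rw [mul_multiplierCoe]
      simp
    have h1 : (1 - (e k : 𝓜(ℂ, A))) * ((z n * star (z n) : A) : 𝓜(ℂ, A)) *
        star (1 - (e k : 𝓜(ℂ, A))) = ((1 - (e k : 𝓜(ℂ, A))) * (z n : 𝓜(ℂ, A))) *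
          star ((1 - (e k : 𝓜(ℂ, A))) * (z n : 𝓜(ℂ, A))) := by
      have hst : ((star (z n) : A) : 𝓜(ℂ, A)) = star (z n : 𝓜(ℂ, A)) :=
        map_star (DoubleCentralizer.coeHom (𝕜 := ℂ) (A := A)) (z n)
      rw [multiplierCoe_mul, star_mul, hst]
      simp only [mul_assoc]
    rw [h1, CStarRing.norm_self_mul_star, hconj, hconj, norm_multiplierCoe, ← sq] at key
    refine key.trans ((norm_mul_le _ _).trans ?_)
    rw [norm_star, norm_multiplierCoe, mul_comm]
    gcongr
    · refine (norm_sub_le _ _).trans ?_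
      rw [norm_multiplierCoe]
      have : ‖(1 : 𝓜(ℂ, A))‖ ≤ 1 := by
        have := CStarRing.norm_star_mul_self (x := (1 : 𝓜(ℂ, A)))
        rw [star_one, mul_one] at this
        nlinarith [norm_nonneg (1 : 𝓜(ℂ, A))]
      linarith [he1 k]
    · exact hh0.norm_sub_ramp_mul_le k
  have hzlim : ∀ n, Tendsto (fun k => e k * z n) atTop (𝓝 (z n)) := fun n => by
    have h2 : Tendsto (fun k : ℕ => 2 * (1 / 2 : ℝ) ^ k) atTop (𝓝 0) := by
      simpa using (tendsto_pow_atTop_nhds_zero_of_lt_one (r := (1 / 2 : ℝ)) (by norm_num)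
        (by norm_num)).const_mul 2
    have h3 := (squeeze_zero (fun k => sq_nonneg _) (hest n) h2).sqrt
    simp only [Real.sqrt_sq (norm_nonneg _), Real.sqrt_zero] at h3
    rw [tendsto_iff_norm_sub_tendsto_zero]
    simpa only [norm_sub_rev] using h3
  refine ⟨e, fun k => cfcₙ_predicate _ _, he1, fun k j hkj =>
    cfcₙ_ramp_mul_ramp (by positivity) (by positivity) zero_le_one zero_le_one ?_ h, fun x => ?_⟩
  · have : (2 : ℝ) ^ (k + 1 + 1) ≤ 2 ^ (j + 1) := pow_le_pow_right₀ (by norm_num) (by omega)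
    rw [pow_succ] at this
    linarith
  · have hux : ∀ n, Tendsto (fun k => e k * (u n * x)) atTop (𝓝 (u n * x)) := fun n => by
      have : u n * x = z n * (((1 / 2 : ℂ) ^ n)⁻¹ • (b n * x)) := by
        rw [hz, hb n]
        dsimp only
        rw [smul_mul_smul_comm, mul_inv_cancel₀ (pow_ne_zero n (by norm_num)), one_smul,
          mul_assoc]
      rw [this]
      simpa only [mul_assoc] using (hzlim n).mul_const (((1 / 2 : ℂ) ^ n)⁻¹ • (b n * x))
    rw [Metric.tendsto_atTop]
    intro ε hε
    obtain ⟨n, hn⟩ := ((Metric.tendsto_atTop.1 (hlim x).1) (ε / 3) (by positivity))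
    have hn := hn n le_rfl
    obtain ⟨K, hK⟩ := (Metric.tendsto_atTop.1 (hux n)) (ε / 3) (by positivity)
    refine ⟨K, fun k hk => ?_⟩
    have h1 : dist (e k * x) (e k * (u n * x)) ≤ dist (u n * x) x := by
      rw [dist_eq_norm, ← mul_sub, dist_comm, dist_eq_norm]
      calc _ ≤ ‖e k‖ * ‖x - u n * x‖ := norm_mul_le _ _
        _ ≤ 1 * ‖x - u n * x‖ := by gcongr; exact he1 k
        _ = _ := one_mul _
    calc dist (e k * x) x ≤ dist (e k * x) (e k * (u n * x)) + dist (e k * (u n * x)) (u n * x)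
          + dist (u n * x) x := dist_triangle4 _ _ _ _
      _ < ε := by linarith [hK k hk]

theorem IsNestedApproxUnit.comp {e : ℕ → A} (he : IsNestedApproxUnit e) {φ : ℕ → ℕ}
    (hφ : StrictMono φ) : IsNestedApproxUnit (e ∘ φ) where
  selfAdjoint _ := he.selfAdjoint _
  norm_le_one _ := he.norm_le_one _
  mul_eq _ _ hkj := he.mul_eq _ _ (hφ hkj)
  tendsto x := (he.tendsto x).comp hφ.tendsto_atTop

/-- A nested approximate unit can be thinned out so as to be almost invariant under `X`. -/
theorem IsNestedApproxUnit.exists_norm_sub_le {e : ℕ → A} (he : IsNestedApproxUnit e)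
    (X : 𝓜(ℂ, A)) : ∃ φ : ℕ → ℕ, StrictMono φ ∧
      ∀ k, ‖X.fst (e (φ k)) - e (φ (k + 1)) * X.fst (e (φ k))‖ ≤ (1 / 2) ^ k := by
  have hstep : ∀ m k : ℕ, ∃ m', m < m' ∧ ‖X.fst (e m) - e m' * X.fst (e m)‖ ≤ (1 / 2) ^ k := by
    intro m k
    have h := tendsto_iff_norm_sub_tendsto_zero.1 (he.tendsto (X.fst (e m)))
    obtain ⟨m', h1, h2⟩ := ((h.eventually_le_const (by positivity : (0 : ℝ) < (1 / 2) ^ k)).and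
      (eventually_gt_atTop m)).exists
    exact ⟨m', h2, by rwa [norm_sub_rev]⟩
  choose g hg using hstep
  let φ : ℕ → ℕ := fun n => Nat.rec 0 (fun k m => g m k) n
  exact ⟨φ, strictMono_nat_of_lt_succ fun k => (hg (φ k) k).1, fun k => (hg (φ k) k).2⟩

end ApproximateUnit

section BlockDiagonal

variable {A : Type*} [NonUnitalCStarAlgebra A]

theorem multiplier_eq_of_mul_coe_eq {T T' : 𝓜(ℂ, A)}
    (h : ∀ x : A, T * (x : 𝓜(ℂ, A)) = T' * (x : 𝓜(ℂ, A))) : T = T' := by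
  rw [← sub_eq_zero, ← norm_eq_zero, ← DoubleCentralizer.norm_fst, norm_eq_zero]
  ext x
  have := h x
  rw [mul_multiplierCoe, mul_multiplierCoe] at this
  simp [multiplierCoe_injective this]

theorem IsStrictSum.tendsto_sum_mul {t : ℕ → A} {T : 𝓜(ℂ, A)} (hT : IsStrictSum t T) {C : ℝ}
    (hC : ∀ N, ‖∑ i ∈ Finset.range N, t i‖ ≤ C) {y : ℕ → A} {x : A} (hy : Tendsto y atTop (𝓝 x)) :
    Tendsto (fun N => (∑ i ∈ Finset.range N, t i) * y N) atTop (𝓝 (T.fst x)) := by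
  have h : Tendsto (fun N => (∑ i ∈ Finset.range N, t i) * (y N - x)) atTop (𝓝 0) := by
    refine squeeze_zero_norm (fun N => (norm_mul_le _ _).trans
      (mul_le_mul_of_nonneg_right (hC N) (norm_nonneg _))) ?_
    simpa using (tendsto_iff_norm_sub_tendsto_zero.1 hy).const_mul C
  refine (by simpa using h.add (hT.left x) : Tendsto _ _ _).congr fun N => ?_
  rw [← Finset.sum_mul, mul_sub, sub_add_cancel]

/-- The `i`-th block of an approximate unit, with `c = 0, 1` distinguishing two interlaced families
of blocks. -/
def block (e : ℕ → A) (c i : ℕ) : A := e (6 * i + 3 * c + 3) - e (6 * i + 3 * c)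

namespace IsNestedApproxUnit

variable {e : ℕ → A}

theorem isSelfAdjoint_block (he : IsNestedApproxUnit e) (c i : ℕ) : IsSelfAdjoint (block e c i) :=
  (he.selfAdjoint _).sub (he.selfAdjoint _)

theorem norm_block_le (he : IsNestedApproxUnit e) (c i : ℕ) : ‖block e c i‖ ≤ 2 :=
  (norm_sub_le _ _).trans <| by
    linarith [he.norm_le_one (6 * i + 3 * c + 3), he.norm_le_one (6 * i + 3 * c)]

theorem block_mul (he : IsNestedApproxUnit e)
    {c i k : ℕ} (h : k < 6 * i + 3 * c) : block e c i * e k = 0 := by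
  rw [block, sub_mul, he.mul_eq _ _ h, he.mul_eq _ _ (by omega), sub_self]

theorem mul_block (he : IsNestedApproxUnit e)
    {c i k : ℕ} (h : 6 * i + 3 * c + 3 < k) : e k * block e c i = block e c i := by
  rw [block, mul_sub, he.mul_eq _ _ h, he.mul_eq _ _ (by omega)]

theorem block_mul_block (he : IsNestedApproxUnit e)
    {c i j : ℕ} (h : i ≠ j) : block e c i * block e c j = 0 := by
  have key : ∀ {i j}, j < i → block e c i * block e c j = 0 := fun {i j} hij => by
    conv_lhs => enter [2]; rw [block]
    rw [mul_sub, he.block_mul (by omega), he.block_mul (by omega), sub_zero]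
  rcases lt_or_gt_of_ne h with h | h
  · simpa [(he.isSelfAdjoint_block _ _).star_eq] using congrArg star (key h)
  · exact key h

theorem strictlyOrthogonal_block (he : IsNestedApproxUnit e)
    (c : ℕ) : StrictlyOrthogonal (block e c) where
  selfAdjoint := he.isSelfAdjoint_block c
  orth _ _ := he.block_mul_block
  tail x ε hε := by
    obtain ⟨k, hk⟩ := ((tendsto_iff_norm_sub_tendsto_zero.1 (he.tendsto x)).eventually_lt_const
      hε).exists
    refine ⟨e k * x, by rwa [norm_sub_rev], k + 1, fun i hi => ?_⟩
    rw [← mul_assoc, he.block_mul (by omega), zero_mul]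

theorem norm_sum_block_le (he : IsNestedApproxUnit e)
    (c N : ℕ) : ‖∑ i ∈ Finset.range N, block e c i‖ ≤ 2 :=
  (he.strictlyOrthogonal_block c).norm_sum_le zero_le_two (he.norm_block_le c)
    (fun _ => .refl _) _

theorem add_eq_one_sub (he : IsNestedApproxUnit e)
    {F₀ F₁ : 𝓜(ℂ, A)} (h₀ : IsStrictSum (block e 0) F₀)
    (h₁ : IsStrictSum (block e 1) F₁) : F₀ + F₁ = 1 - (e 0 : 𝓜(ℂ, A)) := by
  have hlim : Tendsto (fun N : ℕ => 6 * N) atTop atTop :=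
    tendsto_id.const_mul_atTop' (by norm_num)
  have hblock : ∀ i, block e 0 i + block e 1 i = e (6 * (i + 1)) - e (6 * i) := fun i => by
    simp only [block]
    rw [mul_zero, add_zero, mul_one, mul_add, mul_one, show 6 * i + 3 + 3 = 6 * i + 6 by ring]
    abel
  refine (h₀.add h₁).unique ⟨fun x => ?_, fun x => ?_⟩
  · have := ((he.tendsto x).comp hlim).sub_const (e 0 * x)
    simp only [hblock, ← Finset.sum_mul, Finset.sum_range_sub fun i => e (6 * i)]
    simpa [sub_mul] using this
  · have := (((he.tendsto (star x)).comp hlim).sub_const (e 0 * star x)).star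
    simp only [hblock, ← Finset.mul_sum, Finset.sum_range_sub fun i => e (6 * i)]
    simpa [mul_sub, Function.comp_def, (he.selfAdjoint _).star_eq] using this

/-- Up to limits of elements of `A`, the compression of an almost invariant multiplier `X` to the
blocks of an approximate unit is block diagonal. -/
theorem exists_blockDiagonal (he : IsNestedApproxUnit e)
    {J : ClosedTwoSidedIdealC 𝓜(ℂ, A)} {X : 𝓜(ℂ, A)}
    (hXJ : X ∈ J.carrier) (hX : IsSelfAdjoint X)
    (hXe : ∀ k, ‖X.fst (e k) - e (k + 1) * X.fst (e k)‖ ≤ (1 / 2) ^ k) (c : ℕ) {F : 𝓜(ℂ, A)}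
    (hF : IsStrictSum (block e c) F) :
    ∃ (a : ℕ → A) (D : 𝓜(ℂ, A)), StrictlyOrthogonal a ∧ IsStrictSum a D ∧
      F * X * F - D ∈ closure {y | y ∈ J.carrier ∧ ∃ x : A, (x : 𝓜(ℂ, A)) = y} := by
  set f := block e c with hf
  have hfo : StrictlyOrthogonal f := he.strictlyOrthogonal_block c
  have hcoe : ∀ x y : A, ((x * X.fst y : A) : 𝓜(ℂ, A)) = x * X * (y : 𝓜(ℂ, A)) := fun x y => by
    rw [multiplierCoe_mul, ← mul_multiplierCoe, mul_assoc]
  have hstar : ∀ x : A, ((star x : A) : 𝓜(ℂ, A)) = star (x : 𝓜(ℂ, A)) := fun x =>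
    map_star (DoubleCentralizer.coeHom (𝕜 := ℂ) (A := A)) x
  have hstarX : ∀ x y : A, star (x * X.fst y) = star y * X.fst (star x) := fun x y => by
    apply multiplierCoe_injective
    rw [hstar, hcoe, hcoe, hstar, hstar]
    simp [hX.star_eq, mul_assoc]
  set a : ℕ → A := fun i => f i * X.fst (f i) with ha
  have hsupp : ∀ i, SupportedBy (f i) (a i) := fun i =>
    ⟨fun x hx => by rw [ha]; dsimp only; rw [mul_assoc, ← fst_mul_apply, hx, map_zero, mul_zero],
      fun x hx => by rw [ha]; dsimp only; rw [← mul_assoc, hx, zero_mul]⟩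
  have hfstnorm : ∀ x : A, ‖X.fst x‖ ≤ ‖X‖ * ‖x‖ := fun x => by
    rw [← DoubleCentralizer.norm_fst]
    exact X.fst.le_opNorm x
  have hanorm : ∀ i, ‖a i‖ ≤ 2 * (‖X‖ * 2) := fun i =>
    (norm_mul_le _ _).trans <| by
      gcongr
      · exact he.norm_block_le c i
      · exact (hfstnorm _).trans (by gcongr; exact he.norm_block_le c i)
  have haself : ∀ i, IsSelfAdjoint (a i) := fun i => by
    rw [isSelfAdjoint_iff, ha]
    dsimp only
    rw [hstarX, (hfo.selfAdjoint i).star_eq]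
  obtain ⟨D, hD⟩ := hfo.exists_isStrictSum (by positivity) hanorm hsupp
  refine ⟨a, D, hfo.of_supportedBy haself hsupp, hD, ?_⟩
  set G : ℕ → A := fun N => ∑ i ∈ Finset.range N, f i with hG
  have hGself : ∀ N, IsSelfAdjoint (G N) := fun N =>
    isSelfAdjoint_sum _ fun i _ => hfo.selfAdjoint i
  set E : ℕ → A := fun N => G N * X.fst (G N) - ∑ i ∈ Finset.range N, a i with hE
  have hoff : ∀ N, ‖f N * X.fst (G N)‖ ≤ 4 * (1 / 2) ^ N := fun N => by
    rcases Nat.eq_zero_or_pos N with rfl | hN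
    · simp [hG]
    obtain ⟨k, hk⟩ : ∃ k, k + 2 = 6 * N + 3 * c := ⟨6 * N + 3 * c - 2, by omega⟩
    have h1 : e k * G N = G N := by
      rw [hG]
      dsimp only
      rw [Finset.mul_sum]
      refine Finset.sum_congr rfl fun i hi => he.mul_block ?_
      have := Finset.mem_range.1 hi
      omega
    have h2 : f N * X.fst (G N) = f N * (X.fst (e k) - e (k + 1) * X.fst (e k)) * G N := by
      rw [mul_sub, ← mul_assoc, he.block_mul (by omega), zero_mul, sub_zero, mul_assoc,
        ← fst_mul_apply, h1]
    rw [h2]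
    calc _ ≤ ‖f N‖ * ‖X.fst (e k) - e (k + 1) * X.fst (e k)‖ * ‖G N‖ :=
          (norm_mul_le _ _).trans (by gcongr; exact norm_mul_le _ _)
      _ ≤ 2 * (1 / 2) ^ N * 2 := by
          gcongr
          · exact he.norm_block_le c N
          · exact (hXe k).trans (pow_le_pow_of_le_one (by norm_num) (by norm_num) (by omega))
          · exact he.norm_sum_block_le c N
      _ = 4 * (1 / 2) ^ N := by ring
  have hstep : ∀ N, dist (E N) (E (N + 1)) ≤ 8 * (1 / 2) ^ N := fun N => by
    have h1 : E (N + 1) - E N = f N * X.fst (G N) + star (f N * X.fst (G N)) := by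
      rw [hstarX, (hGself N).star_eq, (hfo.selfAdjoint N).star_eq]
      simp only [hE, hG, ha, Finset.sum_range_succ, map_add, mul_add, add_mul]
      abel
    rw [dist_comm, dist_eq_norm, h1]
    refine (norm_add_le _ _).trans ?_
    rw [norm_star]
    linarith [hoff N]
  obtain ⟨E', hE'⟩ := cauchySeq_tendsto_of_complete
    (cauchySeq_of_le_geometric (1 / 2) 8 (by norm_num) hstep)
  have hlim : F * X * F - D = (E' : 𝓜(ℂ, A)) := by
    refine multiplier_eq_of_mul_coe_eq fun x => ?_
    have hx : F.fst (X.fst (F.fst x)) - D.fst x = E' * x := by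
      refine tendsto_nhds_unique (Tendsto.sub (hF.tendsto_sum_mul (he.norm_sum_block_le c)
        ((X.fst.continuous.tendsto _).comp (hF.left x))) (hD.left x)) ((hE'.mul_const x).congr ?_)
      intro N
      simp only [hE, hG, Function.comp_apply, ← Finset.sum_mul, sub_mul, mul_assoc, fst_mul_apply]
    rw [mul_multiplierCoe, mul_multiplierCoe]
    exact congrArg _ hx
  have hcont := continuous_of_nonUnitalStarAlgHom (DoubleCentralizer.coeHom (𝕜 := ℂ) (A := A))
  rw [hlim]
  refine mem_closure_of_tendsto ((hcont.tendsto E').comp hE')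
    (Eventually.of_forall fun N => ⟨?_, E N, rfl⟩)
  have hmem : ∀ x y : A, ((x * X.fst y : A) : 𝓜(ℂ, A)) ∈ J.carrier := fun x y => by
    rw [hcoe]
    exact J.mul_mem_right _ _ (J.mul_mem_left _ _ hXJ)
  rw [Function.comp_apply, map_sub, map_sum (DoubleCentralizer.coeHom (𝕜 := ℂ) (A := A)) a]
  exact sub_mem (hmem _ _) (sum_mem fun i _ => hmem _ _)

end IsNestedApproxUnit

end BlockDiagonal

section ElementaryQuotients

variable {A : Type*} [NonUnitalCStarAlgebra A] {S : Type*} [CuSemigroup S]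
  (hS : IsCuntzSemigroupOf A S) {J : ClosedTwoSidedIdealC 𝓜(ℂ, A)}
  {H : Type*} [NormedAddCommGroup H] [InnerProductSpace ℂ H] [CompleteSpace H]
  {ψ : J.carrier →⋆ₙₐ[ℂ] (H →L[ℂ] H)}

theorem multiplierCoe_mul_multiplier (T : 𝓜(ℂ, A)) (x : A) :
    (x : 𝓜(ℂ, A)) * T = (T.snd x : A) := by
  refine multiplier_eq_of_mul_coe_eq fun y => ?_
  rw [mul_assoc, mul_multiplierCoe, ← multiplierCoe_mul, ← multiplierCoe_mul, T.central]

theorem map_eq_zero_of_mem_closure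
    (hψ : ∀ (a : A) (h : (a : 𝓜(ℂ, A)) ∈ J.carrier), ψ ⟨a, h⟩ = 0) {y : 𝓜(ℂ, A)}
    (hy : y ∈ closure {y | y ∈ J.carrier ∧ ∃ x : A, (x : 𝓜(ℂ, A)) = y}) :
    ∃ h : y ∈ J.carrier, ψ ⟨y, h⟩ = 0 := by
  have hclosed : IsClosed (Subtype.val '' {y : J.carrier | ψ y = 0}) :=
    J.isClosed.isClosedEmbedding_subtypeVal.isClosedMap _
      (isClosed_singleton.preimage (continuous_of_nonUnitalStarAlgHom ψ))
  obtain ⟨⟨z, hz⟩, h, rfl⟩ := closure_minimal (fun y hy => by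
    obtain ⟨h, x, rfl⟩ := hy
    exact ⟨⟨x, h⟩, hψ x h, rfl⟩) hclosed hy
  exact ⟨hz, h⟩

theorem map_mul_eq_rankOne {x x₀ : J.carrier} {u v : H}
    (h : ψ x₀ = InnerProductSpace.rankOne ℂ u v) :
    ψ (x * x₀) = InnerProductSpace.rankOne ℂ (ψ x u) v := by
  rw [map_mul, h, ContinuousLinearMap.mul_def, InnerProductSpace.comp_rankOne]

/-- Under uniform divisibility, a representation of an ideal of the multiplier algebra whose range
is the algebra of compact operators vanishes on the elements of `A`. -/
theorem map_multiplierCoe_eq_zero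
    (hdiv : ∀ a : ℕ → A, (∀ i, CStarNonneg (a i)) → (∀ i j, i ≠ j → a i * a j = 0) →
      ∃ m n : ℕ, 1 ≤ m ∧ 1 ≤ n ∧
        ∀ i, CuDiv.IsWeaklyDivisible (2 * m) n (m • hS.clsA (a i)))
    (hrange : Set.range ψ = {T : H →L[ℂ] H | IsCompactOperator ⇑T})
    (a : A) (h : (a : 𝓜(ℂ, A)) ∈ J.carrier) : ψ ⟨a, h⟩ = 0 := by
  by_contra hne
  obtain ⟨u, hu⟩ : ∃ u, ψ ⟨a, h⟩ u ≠ 0 := by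
    by_contra! hall
    exact hne (ContinuousLinearMap.ext hall)
  have hu0 : u ≠ 0 := by
    rintro rfl
    exact hu (map_zero _)
  obtain ⟨x, hx⟩ := exists_map_eq_rankOne hrange u u
  set y : J.carrier := ⟨a, h⟩ * x with hy
  set z : A := (x : 𝓜(ℂ, A)).snd a with hz
  have hyz : (y : 𝓜(ℂ, A)) = z := multiplierCoe_mul_multiplier _ _
  have hsum : IsStrictSum (fun i : ℕ => if i = 0 then z * star z else 0)
      ((y * star y : J.carrier) : 𝓜(ℂ, A)) := by
    have : ((y * star y : J.carrier) : 𝓜(ℂ, A)) = ((z * star z : A) : 𝓜(ℂ, A)) := by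
      rw [multiplierCoe_mul]
      change (y : 𝓜(ℂ, A)) * star (y : 𝓜(ℂ, A)) = _
      rw [hyz]
      exact congrArg _ (map_star (DoubleCentralizer.coeHom (𝕜 := ℂ) (A := A)) z).symm
    rw [this]
    exact isStrictSum_single _
  refine map_strictSum_ne_rankOne_mul_star hS ψ hdiv
    (strictlyOrthogonal_single (IsSelfAdjoint.mul_star_self z)) _ hsum hu hu0 ?_
  rw [map_mul, map_star, hy, map_mul_eq_rankOne hx]

/-- Under uniform divisibility, no ideal of the multiplier algebra of a σ-unital algebra has a
nonzero representation whose range is the algebra of compact operators. -/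
theorem map_eq_zero_of_range_eq_compact (hsigma : SigmaUnital A)
    (hdiv : ∀ a : ℕ → A, (∀ i, CStarNonneg (a i)) → (∀ i j, i ≠ j → a i * a j = 0) →
      ∃ m n : ℕ, 1 ≤ m ∧ 1 ≤ n ∧
        ∀ i, CuDiv.IsWeaklyDivisible (2 * m) n (m • hS.clsA (a i)))
    (hrange : Set.range ψ = {T : H →L[ℂ] H | IsCompactOperator ⇑T}) (x : J.carrier) :
    ψ x = 0 := by
  have hA := map_multiplierCoe_eq_zero hS hdiv hrange
  ext v
  by_contra hv
  have hv0 : v ≠ 0 := by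
    rintro rfl
    exact hv (by simp)
  obtain ⟨x₀, hx₀⟩ := exists_map_eq_rankOne hrange v v
  set Y : J.carrier := x₀ * x₀ with hY
  set X : J.carrier := Y * star Y with hX
  have hXs : IsSelfAdjoint (X : 𝓜(ℂ, A)) := IsSelfAdjoint.mul_star_self (Y : 𝓜(ℂ, A))
  obtain ⟨e', he'⟩ := hsigma.exists_isNestedApproxUnit
  obtain ⟨φ, hφ, hφX⟩ := he'.exists_norm_sub_le (X : 𝓜(ℂ, A))
  have he := he'.comp hφ
  set e := e' ∘ φ
  have hF : ∀ c, ∃ F, IsStrictSum (block e c) F := fun c =>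
    (he.strictlyOrthogonal_block c).exists_isStrictSum zero_le_two (he.norm_block_le c)
      fun _ => .refl _
  choose F hF using hF
  have hmul : ∀ T : 𝓜(ℂ, A), T * Y ∈ J.carrier := fun T => J.mul_mem_left T _ Y.2
  have hzero : ∀ c, ψ ⟨F c * Y, hmul _⟩ = 0 := fun c => by
    by_contra hne
    set x₁ : J.carrier := ⟨F c * x₀, J.mul_mem_left _ _ x₀.2⟩
    have hFY : (⟨F c * Y, hmul _⟩ : J.carrier) = x₁ * x₀ := Subtype.ext (mul_assoc _ _ _).symm
    rw [hFY, map_mul_eq_rankOne hx₀] at hne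
    obtain ⟨a, D, ha, hD, hcl⟩ := he.exists_blockDiagonal X.2 hXs hφX c (hF c)
    obtain ⟨hmem, hψD⟩ := map_eq_zero_of_mem_closure hA hcl
    have hFs : IsSelfAdjoint (F c) := (hF c).isSelfAdjoint (he.isSelfAdjoint_block c)
    set y : J.carrier := x₁ * x₀ with hy
    have hyc : ((y * star y : J.carrier) : 𝓜(ℂ, A)) = F c * X * F c := by
      change (F c * x₀ * x₀) * star (F c * x₀ * x₀ : 𝓜(ℂ, A)) =
        F c * ((x₀ * x₀) * star (x₀ * x₀ : 𝓜(ℂ, A))) * F c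
      simp only [star_mul, hFs.star_eq, mul_assoc]
    let d : J.carrier := y * star y - ⟨_, hmem⟩
    have hd : (d : 𝓜(ℂ, A)) = D := by
      change ((y * star y : J.carrier) : 𝓜(ℂ, A)) - (F c * X * F c - D) = D
      rw [hyc, sub_sub_cancel]
    refine map_strictSum_ne_rankOne_mul_star hS ψ hdiv ha d (hd ▸ hD) (w := ψ x₁ v) (u := v)
      (fun h => hne (by rw [h]; simp)) hv0 ?_
    rw [map_sub, hψD, sub_zero, map_mul, map_star, map_mul_eq_rankOne hx₀]
  have hY0 : ψ Y = 0 := by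
    have hsplit : Y = ⟨F 0 * Y, hmul _⟩ + ⟨F 1 * Y, hmul _⟩ + ⟨(e 0 : 𝓜(ℂ, A)) * Y, hmul _⟩ := by
      refine Subtype.ext ?_
      change (Y : 𝓜(ℂ, A)) = F 0 * Y + F 1 * Y + (e 0 : 𝓜(ℂ, A)) * Y
      rw [← add_mul, he.add_eq_one_sub (hF 0) (hF 1), ← add_mul, sub_add_cancel, one_mul]
    have he0 : ψ ⟨(e 0 : 𝓜(ℂ, A)) * Y, hmul _⟩ = 0 := by
      have := hmul (e 0)
      simp only [multiplierCoe_mul_multiplier] at this ⊢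
      exact hA _ this
    rw [hsplit, map_add, map_add, hzero, hzero, he0, add_zero, add_zero]
  rw [hY, map_mul_eq_rankOne hx₀, hx₀, InnerProductSpace.rankOne_eq_zero] at hY0
  simp [hv0] at hY0

end ElementaryQuotients

/-- Theorem 5.5 / Theorem A.  Let `A` be a σ-unital C*-algebra.  If for
every sequence of pairwise orthogonal positive elements `(aᵢ)` of `A` there are
`m, n ∈ ℕ` such that `m·[aᵢ]` is weakly `(2m, n)`-divisible in `Cu(A)` for every `i`,
then the multiplier algebra `𝓜(A)` is nowhere scattered. -/
theorem multiplier_nowhereScattered_of_bounded_divisibility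
    (A : Type) [NonUnitalCStarAlgebra A] (S : Type) [CuSemigroup S]
    (hS : IsCuntzSemigroupOf A S)
    (hsigma : SigmaUnital A)
    (hdiv : ∀ a : ℕ → A, (∀ i, CStarNonneg (a i)) → (∀ i j, i ≠ j → a i * a j = 0) →
      ∃ m n : ℕ, 1 ≤ m ∧ 1 ≤ n ∧
        ∀ i, CuDiv.IsWeaklyDivisible (2 * m) n (m • hS.clsA (a i))) :
    NowhereScattered 𝓜(ℂ, A) := by
  rintro ⟨J, H, _, _, _, ψ, hrange, x, hx⟩
  exact hx (map_eq_zero_of_range_eq_compact hS hsigma hdiv hrange x)
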